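/- arXiv:2408.02428 — 2 statements merged into one kernel-verified Lean document; each statement's English description precedes it below -/
import Mathlib

section
/- Let m,n ≥ 2, let ε = (ε_1,…,ε_{min{m,n}}) ∈ {1,−1}^{min{m,n}} be a given sign pattern, and let 𝓛 : ℝ^{m×n} → ℝ^{m×n} be a linear transformation. Then the following are equivalent: (1) 𝓛 maps the set of SSR(ε) matrices onto itself; (2) 𝓛 maps the set of SSR₂((ε_1,ε_2)) matrices onto itself; (3) 𝓛 is a composition of one or more of the following transformations: (a) A ↦ F·A·E, where F ∈ ℝ^{m×m} and E ∈ ℝ^{n×n} are diagonal matrices with positive diagonal entries; (b) A ↦ P_m·A·P_n, where P_m, P_n are exchange matrices; and (c) A ↦ Aᵀ, the last being allowed only when m = n. -/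
open Matrix

/-- The `n × n` exchange matrix: ones on the antidiagonal, zeros elsewhere. -/
def exchangeMat (n : ℕ) : Matrix (Fin n) (Fin n) ℝ :=
  Matrix.of fun i j => if j = i.rev then (1 : ℝ) else 0

/-- `A` is strictly sign regular of order `k` with sign pattern `ε` (SSRₖ(ε)):
for each `1 ≤ r ≤ k`, every `r × r` minor of `A` has sign `ε r`. -/
def IsSSRkPat {m n : ℕ} (k : ℕ) (ε : ℕ → ℝ) (A : Matrix (Fin m) (Fin n) ℝ) : Prop :=
  ∀ r : ℕ, 1 ≤ r → r ≤ k →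
    ∀ (f : Fin r → Fin m) (g : Fin r → Fin n),
      StrictMono f → StrictMono g →
      0 < ε r * (A.submatrix f g).det

/-- The elementary transformations (a)–(c) of positive diagonal
equivalence, `A ↦ Pₘ A Pₙ` with exchange matrices, and (when `m = n`)
transposition. -/
def ElemSSRPatMap (m n : ℕ)
    (T : Matrix (Fin m) (Fin n) ℝ → Matrix (Fin m) (Fin n) ℝ) : Prop :=
  (∃ F : Fin m → ℝ, ∃ Ed : Fin n → ℝ, (∀ i, 0 < F i) ∧ (∀ j, 0 < Ed j) ∧
      T = fun A => Matrix.diagonal F * A * Matrix.diagonal Ed) ∨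
  (T = fun A => exchangeMat m * A * exchangeMat n) ∨
  (∃ h : m = n,
      T = fun A => Matrix.of fun i j => A (Fin.cast h.symm j) (Fin.cast h i))

section

open Filter Topology

variable {m n : ℕ}

theorem isOpen_setOf_isSSRkPat (k : ℕ) (ε : ℕ → ℝ) :
    IsOpen {A : Matrix (Fin m) (Fin n) ℝ | IsSSRkPat k ε A} := by
  have h : {A : Matrix (Fin m) (Fin n) ℝ | IsSSRkPat k ε A} =
      ⋂ r ∈ Finset.Icc 1 k, ⋂ f : Fin r → Fin m, ⋂ g : Fin r → Fin n,
        {A | StrictMono f → StrictMono g → 0 < ε r * (A.submatrix f g).det} := by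
    ext A
    simp [IsSSRkPat]
  rw [h]
  refine isOpen_biInter_finset fun r _ => isOpen_iInter_of_finite fun f =>
    isOpen_iInter_of_finite fun g => ?_
  by_cases hf : StrictMono f
  · by_cases hg : StrictMono g
    · simp only [hf, hg, forall_true_left]
      exact isOpen_lt continuous_const
        (continuous_const.mul (continuous_id.matrix_submatrix f g).matrix_det)
    · simp [hg]
  · simp [hf]

theorem det_vandermonde_pos {r : ℕ} {v : Fin r → ℝ} (hv : StrictMono v) :
    0 < (vandermonde v).det := by
  rw [det_vandermonde]
  exact Finset.prod_pos fun i _ => Finset.prod_pos fun j hj =>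
    sub_pos.2 (hv (Finset.mem_Ioi.1 hj))

/-- The weighted sum `∑ q < r, δ q • (x i ^ q * y j ^ q)` of rank-one power matrices. -/
def powerKernel (x : Fin m → ℝ) (y : Fin n → ℝ) (δ : ℕ → ℝ) (r : ℕ) :
    Matrix (Fin m) (Fin n) ℝ :=
  Matrix.of fun i j => ∑ q ∈ Finset.range r, δ q * (x i ^ q * y j ^ q)

theorem det_powerKernel_submatrix (x : Fin m → ℝ) (y : Fin n → ℝ) (δ : ℕ → ℝ) {r : ℕ}
    (f : Fin r → Fin m) (g : Fin r → Fin n) :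
    ((powerKernel x y δ r).submatrix f g).det =
      (vandermonde (x ∘ f)).det * (∏ q ∈ Finset.range r, δ q) * (vandermonde (y ∘ g)).det := by
  have h : (powerKernel x y δ r).submatrix f g =
      vandermonde (x ∘ f) * diagonal (fun q : Fin r => δ q) * (vandermonde (y ∘ g))ᵀ := by
    ext i j
    rw [mul_apply]
    simp only [powerKernel, submatrix_apply, of_apply, mul_diagonal, vandermonde_apply,
      transpose_apply, Finset.sum_range, Function.comp]
    exact Finset.sum_congr rfl fun q _ => by ring
  rw [h, det_mul, det_mul, det_diagonal, det_transpose, Finset.prod_range]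

theorem isSSRkPat_powerKernel_succ {x : Fin m → ℝ} {y : Fin n → ℝ} (hx : StrictMono x)
    (hy : StrictMono y) {δ ε : ℕ → ℝ} {r : ℕ}
    (hδ : 0 < ε (r + 1) * ∏ q ∈ Finset.range (r + 1), δ q)
    (h : IsSSRkPat r ε (powerKernel x y δ (r + 1))) :
    IsSSRkPat (r + 1) ε (powerKernel x y δ (r + 1)) := by
  intro s hs1 hs f g hf hg
  rcases hs.lt_or_eq with hs | rfl
  · exact h s hs1 (by omega) f g hf hg
  · rw [det_powerKernel_submatrix]
    have := mul_pos hδ (mul_pos (det_vandermonde_pos (hx.comp hf)) (det_vandermonde_pos (hy.comp hg)))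
    linarith

/-- A sign-regular power kernel of order `r` is a limit of sign-regular matrices of any higher
order with prescribed signs. -/
theorem powerKernel_mem_closure {x : Fin m → ℝ} {y : Fin n → ℝ} (hx : StrictMono x)
    (hy : StrictMono y) {ε : ℕ → ℝ} {k r : ℕ} (hrk : r ≤ k)
    (hε : ∀ s, 1 ≤ s → s ≤ k → ε s = 1 ∨ ε s = -1) (δ : ℕ → ℝ)
    (hδ : 0 < ε r * ∏ q ∈ Finset.range r, δ q) (h : IsSSRkPat r ε (powerKernel x y δ r)) :
    powerKernel x y δ r ∈ closure {A | IsSSRkPat k ε A} := by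
  induction hrk using Nat.decreasingInduction generalizing δ with
  | self => exact subset_closure h
  | of_succ r hr ih =>
    have hr0 : ε (r + 1) ≠ 0 := by
      rcases hε (r + 1) (by omega) hr with h | h <;> simp [h]
    set P := ∏ q ∈ Finset.range r, δ q with hP
    have hP0 : P ≠ 0 := fun h0 => by simp [h0] at hδ
    let D : ℝ → ℕ → ℝ := fun t => Function.update δ r (t * (ε (r + 1) * P))
    have hD : ∀ t, ∀ q ∈ Finset.range r, D t q = δ q := fun t q hq =>
      Function.update_of_ne (Finset.mem_range.1 hq).ne _ _
    have hDr : ∀ t, D t r = t * (ε (r + 1) * P) := fun t => Function.update_self _ _ _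
    have hker : ∀ t i j, powerKernel x y (D t) (r + 1) i j =
        powerKernel x y δ r i j + t * (ε (r + 1) * P) * (x i ^ r * y j ^ r) := by
      intro t i j
      simp only [powerKernel, of_apply, Finset.sum_range_succ, hDr]
      congr 1
      exact Finset.sum_congr rfl fun q hq => by rw [hD t q hq]
    have hcont : Continuous fun t => powerKernel x y (D t) (r + 1) := by
      refine continuous_matrix fun i j => ?_
      simp only [hker]
      fun_prop
    have h0 : powerKernel x y (D 0) (r + 1) = powerKernel x y δ r := by
      ext i j
      simp [hker]
    have hev : ∀ᶠ t in 𝓝[>] (0 : ℝ), IsSSRkPat r ε (powerKernel x y (D t) (r + 1)) := by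
      refine (hcont.tendsto 0).mono_left nhdsWithin_le_nhds |>.eventually ?_
      rw [h0]
      exact (isOpen_setOf_isSSRkPat r ε).mem_nhds h
    rw [← h0]
    refine isClosed_closure.mem_of_tendsto ((hcont.tendsto 0).mono_left nhdsWithin_le_nhds)
      (b := 𝓝[>] (0 : ℝ)) ?_
    filter_upwards [hev, self_mem_nhdsWithin] with t ht ht0
    have hprod : 0 < ε (r + 1) * ∏ q ∈ Finset.range (r + 1), D t q := by
      rw [Finset.prod_range_succ, Finset.prod_congr rfl (hD t), hDr]
      have : 0 < t * ((ε (r + 1)) ^ 2 * P ^ 2) :=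
        mul_pos ht0 (by positivity)
      linarith
    exact ih (D t) hprod (isSSRkPat_powerKernel_succ hx hy hprod ht)

theorem IsSSRkPat.diagonal_mul_mul_diagonal {k : ℕ} {ε : ℕ → ℝ} {A : Matrix (Fin m) (Fin n) ℝ}
    (hA : IsSSRkPat k ε A) {u : Fin m → ℝ} {v : Fin n → ℝ} (hu : ∀ i, 0 < u i)
    (hv : ∀ j, 0 < v j) : IsSSRkPat k ε (diagonal u * A * diagonal v) := by
  intro r hr1 hr f g hf hg
  have h : (diagonal u * A * diagonal v).submatrix f g =
      diagonal (u ∘ f) * A.submatrix f g * diagonal (v ∘ g) := by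
    ext i j
    simp
  rw [h, det_mul, det_mul, det_diagonal, det_diagonal]
  have hU : 0 < ∏ i, (u ∘ f) i := Finset.prod_pos fun i _ => hu (f i)
  have hV : 0 < ∏ i, (v ∘ g) i := Finset.prod_pos fun i _ => hv (g i)
  have := mul_pos (mul_pos hU hV) (hA r hr1 hr f g hf hg)
  linarith

theorem exchangeMat_mul_mul_exchangeMat (A : Matrix (Fin m) (Fin n) ℝ) :
    exchangeMat m * A * exchangeMat n = A.submatrix Fin.rev Fin.rev := by
  ext i j
  have h : ∀ x : Fin n, j = x.rev ↔ x = j.rev := fun x => eq_comm.trans Fin.rev_eq_iff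
  simp [exchangeMat, mul_apply, h]

theorem IsSSRkPat.submatrix_rev {k : ℕ} {ε : ℕ → ℝ} {A : Matrix (Fin m) (Fin n) ℝ}
    (hA : IsSSRkPat k ε A) : IsSSRkPat k ε (A.submatrix Fin.rev Fin.rev) := by
  intro r hr1 hr f g hf hg
  have h := hA r hr1 hr (Fin.rev ∘ f ∘ Fin.rev) (Fin.rev ∘ g ∘ Fin.rev)
    (fun a b hab => Fin.rev_lt_rev.2 (hf (Fin.rev_lt_rev.2 hab)))
    (fun a b hab => Fin.rev_lt_rev.2 (hg (Fin.rev_lt_rev.2 hab)))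
  have he : A.submatrix (Fin.rev ∘ f ∘ Fin.rev) (Fin.rev ∘ g ∘ Fin.rev) =
      ((A.submatrix Fin.rev Fin.rev).submatrix f g).submatrix Fin.revPerm Fin.revPerm := rfl
  rwa [he, det_submatrix_equiv_self] at h

theorem IsSSRkPat.transpose {k : ℕ} {ε : ℕ → ℝ} {A : Matrix (Fin m) (Fin n) ℝ}
    (hA : IsSSRkPat k ε A) : IsSSRkPat k ε Aᵀ := by
  intro r hr1 hr f g hf hg
  rw [← transpose_submatrix, det_transpose]
  exact hA r hr1 hr g f hg hf

theorem ElemSSRPatMap.isSSRkPat {T : Matrix (Fin m) (Fin n) ℝ → Matrix (Fin m) (Fin n) ℝ}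
    (hT : ElemSSRPatMap m n T) {k : ℕ} {ε : ℕ → ℝ} {A : Matrix (Fin m) (Fin n) ℝ}
    (hA : IsSSRkPat k ε A) : IsSSRkPat k ε (T A) := by
  rcases hT with ⟨u, v, hu, hv, rfl⟩ | rfl | ⟨rfl, rfl⟩
  · exact hA.diagonal_mul_mul_diagonal hu hv
  · simpa only [exchangeMat_mul_mul_exchangeMat] using hA.submatrix_rev
  · exact hA.transpose

theorem ElemSSRPatMap.exists_rightInverse
    {T : Matrix (Fin m) (Fin n) ℝ → Matrix (Fin m) (Fin n) ℝ} (hT : ElemSSRPatMap m n T) :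
    ∃ T', ElemSSRPatMap m n T' ∧ ∀ A, T (T' A) = A := by
  rcases hT with ⟨u, v, hu, hv, rfl⟩ | rfl | ⟨rfl, rfl⟩
  · refine ⟨_, Or.inl ⟨fun i => (u i)⁻¹, fun j => (v j)⁻¹, fun i => inv_pos.2 (hu i),
      fun j => inv_pos.2 (hv j), rfl⟩, fun A => ?_⟩
    ext i j
    have := (hu i).ne'
    have := (hv j).ne'
    simp
    field_simp
  · refine ⟨_, Or.inr (Or.inl rfl), fun A => ?_⟩
    simp only [exchangeMat_mul_mul_exchangeMat]
    ext i j
    simp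
  · exact ⟨_, Or.inr (Or.inr ⟨rfl, rfl⟩), fun A => rfl⟩

theorem ElemSSRPatMap.image_setOf_isSSRkPat
    {T : Matrix (Fin m) (Fin n) ℝ → Matrix (Fin m) (Fin n) ℝ} (hT : ElemSSRPatMap m n T)
    (k : ℕ) (ε : ℕ → ℝ) : T '' {A | IsSSRkPat k ε A} = {A | IsSSRkPat k ε A} := by
  obtain ⟨T', hT', hTT'⟩ := hT.exists_rightInverse
  refine Set.Subset.antisymm ?_ fun A hA => ⟨T' A, hT'.isSSRkPat hA, hTT' A⟩
  rintro _ ⟨A, hA, rfl⟩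
  exact hT.isSSRkPat hA

theorem image_foldr_comp_setOf_isSSRkPat
    {L : List (Matrix (Fin m) (Fin n) ℝ → Matrix (Fin m) (Fin n) ℝ)}
    (hL : ∀ T ∈ L, ElemSSRPatMap m n T) (k : ℕ) (ε : ℕ → ℝ) :
    L.foldr (· ∘ ·) id '' {A | IsSSRkPat k ε A} = {A | IsSSRkPat k ε A} := by
  induction L with
  | nil => simp
  | cons T L ih =>
    rw [List.foldr_cons, Set.image_comp, ih fun T hT => hL T (List.mem_cons_of_mem _ hT)]
    exact (hL T List.mem_cons_self).image_setOf_isSSRkPat k ε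

theorem mem_of_continuous_of_eventually_right {X : Type*} [TopologicalSpace X] {C : Set X}
    (hC : IsClosed C) {g : ℝ → X} (hg : Continuous g) (h : ∀ᶠ t in 𝓝[>] (0 : ℝ), g t ∈ C) :
    g 0 ∈ C :=
  hC.mem_of_tendsto ((hg.tendsto 0).mono_left nhdsWithin_le_nhds) h

/-- The matrix with entries `c * (u i * v j * (1 + e * (x i * y j)))`. -/
def bilinearKernel (c e : ℝ) (u x : Fin m → ℝ) (v y : Fin n → ℝ) : Matrix (Fin m) (Fin n) ℝ :=
  Matrix.of fun i j => c * (u i * v j * (1 + e * (x i * y j)))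

section

variable {k : ℕ} {ε : ℕ → ℝ} {u x : Fin m → ℝ} {v y : Fin n → ℝ}

theorem bilinearKernel_one_mem_closure (hk : 2 ≤ k)
    (hε : ∀ s, 1 ≤ s → s ≤ k → ε s = 1 ∨ ε s = -1) (hx : StrictMono x) (hy : StrictMono y)
    (hxy : ∀ i j, 0 < 1 + ε 2 * (x i * y j)) :
    bilinearKernel (ε 1) (ε 2) 1 x 1 y ∈ closure {A | IsSSRkPat k ε A} := by
  have h1 : ε 1 * ε 1 = 1 := by
    rcases hε 1 le_rfl (by omega) with h | h <;> simp [h]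
  have h2 : ε 2 * ε 2 = 1 := by
    rcases hε 2 (by omega) hk with h | h <;> simp [h]
  let δ : ℕ → ℝ := fun q => if q = 0 then ε 1 else ε 1 * ε 2
  have hker : bilinearKernel (ε 1) (ε 2) 1 x 1 y = powerKernel x y δ 2 := by
    ext i j
    simp [bilinearKernel, powerKernel, Finset.sum_range_succ, δ]
    ring
  have hδ : 0 < ε 2 * ∏ q ∈ Finset.range 2, δ q := by
    have : ε 2 * ∏ q ∈ Finset.range 2, δ q = (ε 1 * ε 1) * (ε 2 * ε 2) := by
      simp [Finset.prod_range_succ, δ]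
      ring
    rw [this, h1, h2]
    norm_num
  rw [hker]
  refine powerKernel_mem_closure hx hy hk hε δ hδ (isSSRkPat_powerKernel_succ hx hy hδ ?_)
  intro r hr1 hr f g _ _
  obtain rfl : r = 1 := by omega
  rw [← hker, det_fin_one]
  have := hxy (f 0) (g 0)
  simpa [bilinearKernel, ← mul_assoc, h1] using this

theorem bilinearKernel_pos_mem_closure (hk : 2 ≤ k)
    (hε : ∀ s, 1 ≤ s → s ≤ k → ε s = 1 ∨ ε s = -1) (hu : ∀ i, 0 < u i) (hv : ∀ j, 0 < v j)
    (hx : StrictMono x) (hy : StrictMono y) (hxy : ∀ i j, 0 < 1 + ε 2 * (x i * y j)) :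
    bilinearKernel (ε 1) (ε 2) u x v y ∈ closure {A | IsSSRkPat k ε A} := by
  have h : bilinearKernel (ε 1) (ε 2) u x v y =
      diagonal u * bilinearKernel (ε 1) (ε 2) 1 x 1 y * diagonal v := by
    ext i j
    simp [bilinearKernel]
    ring
  rw [h]
  have hc : Continuous fun A : Matrix (Fin m) (Fin n) ℝ => diagonal u * A * diagonal v := by
    fun_prop
  exact map_mem_closure (f := fun A : Matrix (Fin m) (Fin n) ℝ => diagonal u * A * diagonal v) hc
    (bilinearKernel_one_mem_closure hk hε hx hy hxy)
    fun A hA => IsSSRkPat.diagonal_mul_mul_diagonal hA hu hv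

theorem bilinearKernel_mem_closure (hk : 2 ≤ k)
    (hε : ∀ s, 1 ≤ s → s ≤ k → ε s = 1 ∨ ε s = -1) (hu : ∀ i, 0 ≤ u i) (hv : ∀ j, 0 ≤ v j)
    (hx : Monotone x) (hy : Monotone y) (hxy : ∀ i j, 0 ≤ 1 + ε 2 * (x i * y j)) :
    bilinearKernel (ε 1) (ε 2) u x v y ∈ closure {A | IsSSRkPat k ε A} := by
  have strict : ∀ (x : Fin m → ℝ) (y : Fin n → ℝ) (u : Fin m → ℝ) (v : Fin n → ℝ), Monotone x →
      Monotone y → (∀ i, 0 < u i) → (∀ j, 0 < v j) → (∀ i j, 0 < 1 + ε 2 * (x i * y j)) →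
      bilinearKernel (ε 1) (ε 2) u x v y ∈ closure {A | IsSSRkPat k ε A} := by
    intro x y u v hx hy hu hv hxy
    have hc : Continuous fun t : ℝ => bilinearKernel (ε 1) (ε 2) u (fun i => x i + t * (i : ℕ))
        v (fun j => y j + t * (j : ℕ)) := by
      refine continuous_matrix fun i j => ?_
      simp only [bilinearKernel, of_apply]
      fun_prop
    have hev : ∀ᶠ t in 𝓝[>] (0 : ℝ), ∀ i j,
        0 < 1 + ε 2 * ((x i + t * (i : ℕ)) * (y j + t * (j : ℕ))) := by
      refine eventually_all.2 fun i => eventually_all.2 fun j => ?_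
      have hc' : Continuous fun t : ℝ =>
        1 + ε 2 * ((x i + t * (i : ℕ)) * (y j + t * (j : ℕ))) := by fun_prop
      exact ((hc'.tendsto 0).mono_left nhdsWithin_le_nhds).eventually
        (lt_mem_nhds (by simpa using hxy i j))
    have := mem_of_continuous_of_eventually_right isClosed_closure hc (by
      filter_upwards [hev, self_mem_nhdsWithin] with t ht ht0
      refine bilinearKernel_pos_mem_closure hk hε hu hv (fun a b hab => ?_) (fun a b hab => ?_) ht
      · exact add_lt_add_of_le_of_lt (hx hab.le) (mul_lt_mul_of_pos_left (by exact_mod_cast hab) ht0)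
      · exact add_lt_add_of_le_of_lt (hy hab.le) (mul_lt_mul_of_pos_left (by exact_mod_cast hab) ht0))
    simpa using this
  have hc : Continuous fun t : ℝ => bilinearKernel (ε 1) (ε 2) (fun i => u i + t)
      (fun i => (1 - t) * x i) (fun j => v j + t) y := by
    refine continuous_matrix fun i j => ?_
    simp only [bilinearKernel, of_apply]
    fun_prop
  have := mem_of_continuous_of_eventually_right isClosed_closure hc (by
    filter_upwards [Ioo_mem_nhdsGT (zero_lt_one (α := ℝ))] with t ht
    refine strict _ _ _ _ (fun a b hab => mul_le_mul_of_nonneg_left (hx hab) (by linarith [ht.2])) hy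
      (fun i => by linarith [hu i, ht.1]) (fun j => by linarith [hv j, ht.1]) fun i j => ?_
    have h := mul_nonneg (sub_nonneg.2 ht.2.le) (hxy i j)
    linarith [ht.1])
  simpa using this

end

section

variable {α β : Type*} [Fintype α] [Fintype β] [DecidableEq α] [DecidableEq β]

theorem map_eq_sum_smul_map_single (f : Matrix α β ℝ →ₗ[ℝ] Matrix α β ℝ) (A : Matrix α β ℝ) :
    f A = ∑ p : α × β, A p.1 p.2 • f (single p.1 p.2 1) := by
  conv_lhs => rw [matrix_eq_sum_single A]
  rw [Fintype.sum_prod_type]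
  simp only [map_sum, ← map_smul, smul_single, smul_eq_mul, mul_one]

/-- A linear automorphism which is entrywise nonnegative together with its inverse permutes the
entries up to positive factors. -/
theorem exists_perm_scale (f : Matrix α β ℝ ≃ₗ[ℝ] Matrix α β ℝ)
    (hf : ∀ (p : α × β) i j, 0 ≤ f (single p.1 p.2 1) i j)
    (hg : ∀ (p : α × β) i j, 0 ≤ f.symm (single p.1 p.2 1) i j) :
    ∃ (π : α × β → α × β) (c : α × β → ℝ), Function.Injective π ∧ (∀ p, 0 < c p) ∧
      ∀ A p, f A (π p).1 (π p).2 = c p * A p.1 p.2 := by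
  have hmono : ∀ A : Matrix α β ℝ, (∀ i j, 0 ≤ A i j) → ∀ i j, 0 ≤ f.symm A i j := by
    intro A hA i j
    have := map_eq_sum_smul_map_single f.symm.toLinearMap A
    simp only [LinearEquiv.coe_coe] at this
    rw [this, Matrix.sum_apply]
    exact Finset.sum_nonneg fun p _ => mul_nonneg (hA _ _) (hg p i j)
  have hstep : ∀ p : α × β, ∃ (q : α × β) (a : ℝ), 0 < a ∧
      f (single p.1 p.2 1) = a • single q.1 q.2 1 := by
    intro p
    have hne : f (single p.1 p.2 1) ≠ 0 := by
      rw [Ne, LinearEquiv.map_eq_zero_iff]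
      intro h
      have := congrFun (congrFun h p.1) p.2
      simp at this
    obtain ⟨i, j, hij⟩ : ∃ i j, f (single p.1 p.2 1) i j ≠ 0 := by
      by_contra! h
      exact hne (by ext i j; simpa using h i j)
    set a := f (single p.1 p.2 1) i j with ha
    have hapos : 0 < a := lt_of_le_of_ne (hf p i j) hij.symm
    have hsub := hmono (f (single p.1 p.2 1) - a • single i j 1) (by
      intro i' j'
      by_cases h : i = i' ∧ j = j'
      · obtain ⟨rfl, rfl⟩ := h
        simp [ha]
      · simpa [single_apply_of_ne _ _ _ _ _ h] using hf p i' j')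
    have hsymm : f.symm (single i j 1) = f.symm (single i j 1) p.1 p.2 • single p.1 p.2 1 := by
      ext i' j'
      by_cases h : p.1 = i' ∧ p.2 = j'
      · obtain ⟨rfl, rfl⟩ := h
        simp
      · have h1 := hsub i' j'
        have h2 := hg (i, j) i' j'
        simp only [map_sub, map_smul, LinearEquiv.symm_apply_apply, Matrix.sub_apply,
          Matrix.smul_apply, single_apply_of_ne _ _ _ _ _ h, smul_eq_mul] at h1 h2 ⊢
        nlinarith
    refine ⟨(i, j), a, hapos, ?_⟩
    have h3 := congrArg f hsymm
    rw [map_smul, LinearEquiv.apply_symm_apply] at h3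
    have h4 := congrFun (congrFun h3 i) j
    simp only [single_apply_same, Matrix.smul_apply, ← ha, smul_eq_mul] at h4
    rw [h3, smul_smul, mul_comm a, ← h4, one_smul]
  choose π c hc hπ using hstep
  have hinj : Function.Injective π := by
    intro p q hpq
    have h : f (c q • single p.1 p.2 1) = f (c p • single q.1 q.2 1) := by
      rw [map_smul, map_smul, hπ, hπ, hpq, smul_comm]
    have h' := congrFun (congrFun (f.injective h) p.1) p.2
    by_contra hne
    have hne' : ¬ (q.1 = p.1 ∧ q.2 = p.2) := fun h => hne (Prod.ext h.1.symm h.2.symm)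
    simp [single_apply_of_ne _ _ _ _ _ hne'] at h'
    exact (hc q).ne' h'
  refine ⟨π, c, hinj, hc, fun A p => ?_⟩
  have := map_eq_sum_smul_map_single f.toLinearMap A
  simp only [LinearEquiv.coe_coe] at this
  rw [this, Matrix.sum_apply, Finset.sum_eq_single p]
  · simp [hπ, mul_comm]
  · intro q _ hq
    have hne : ¬ ((π q).1 = (π p).1 ∧ (π q).2 = (π p).2) :=
      fun h => hq (hinj (Prod.ext h.1 h.2))
    simp [hπ, single_apply_of_ne _ _ _ _ _ hne]
  · simp

end

/-- A map of grids sending the two diagonals of each rectangle to the two diagonals of a rectangle,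
and some horizontal pair to a horizontal pair, acts on rows and columns separately. -/
theorem exists_eq_prod_of_rectangle {α β γ δ : Type*} {π : α × β → γ × δ}
    (hπ : Function.Injective π)
    (hR : ∀ i k j l, i ≠ k → j ≠ l →
      ((π (i, j)).1 = (π (i, l)).1 ∧ (π (k, j)).1 = (π (k, l)).1 ∧
        (π (i, j)).2 = (π (k, j)).2 ∧ (π (i, l)).2 = (π (k, l)).2) ∨
      ((π (i, j)).2 = (π (i, l)).2 ∧ (π (k, j)).2 = (π (k, l)).2 ∧
        (π (i, j)).1 = (π (k, j)).1 ∧ (π (i, l)).1 = (π (k, l)).1))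
    {a a' : α} {b b' : β} (ha : a ≠ a') (hb : b ≠ b') (h : (π (a, b)).1 = (π (a, b')).1) :
    ∃ (σ : α → γ) (τ : β → δ), ∀ i j, π (i, j) = (σ i, τ j) := by
  have hne : ∀ {p q : α × β}, p ≠ q → (π p).1 = (π q).1 → (π p).2 = (π q).2 → False :=
    fun hpq h1 h2 => hpq (hπ (Prod.ext h1 h2))
  have hcol : (π (a, b)).2 = (π (a', b)).2 := by
    rcases hR a a' b b' ha hb with H | H
    · exact H.2.2.1
    · exact (hne (by simp [hb]) h H.1).elim
  have hrow : ∀ l, (π (a, b)).1 = (π (a, l)).1 := by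
    intro l
    rcases eq_or_ne b l with rfl | hl
    · rfl
    rcases hR a a' b l ha hl with H | H
    · exact H.1
    · exact (hne (by simp [ha]) H.2.2.1 hcol).elim
  have hrect : ∀ k l, a ≠ k → b ≠ l → (π (k, b)).1 = (π (k, l)).1 ∧
      (π (a, b)).2 = (π (k, b)).2 ∧ (π (a, l)).2 = (π (k, l)).2 := by
    intro k l hk hl
    rcases hR a k b l hk hl with H | H
    · exact H.2
    · exact (hne (by simp [hl]) (hrow l) H.1).elim
  refine ⟨fun i => (π (i, b)).1, fun j => (π (a, j)).2, fun i j => Prod.ext ?_ ?_⟩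
  · rcases eq_or_ne a i with rfl | hi
    · exact (hrow j).symm
    rcases eq_or_ne b j with rfl | hj
    · rfl
    exact (hrect i j hi hj).1.symm
  · rcases eq_or_ne a i with rfl | hi
    · rfl
    rcases eq_or_ne b j with rfl | hj
    · exact (hrect i b' hi hb).2.1.symm
    exact (hrect i j hi hj).2.2.symm

/-- The sign prescribed by `e` for the minor on rows `i, k` and columns `j, l`, up to a positive
factor. -/
def cornerSign (e : ℝ) (i k : Fin m) (j l : Fin n) : ℝ :=
  e * (((k : ℕ) : ℝ) - (i : ℕ)) * (((l : ℕ) : ℝ) - (j : ℕ))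

/-- Entrywise nonnegative matrices whose `2 × 2` minors weakly have the sign of `e`, containing
enough test matrices for the linear automorphisms to be determined. -/
structure IsSignCone (e : ℝ) (K : Set (Matrix (Fin m) (Fin n) ℝ)) : Prop where
  nonneg : ∀ A ∈ K, ∀ i j, 0 ≤ A i j
  minor : ∀ A ∈ K, ∀ i k j l, 0 < cornerSign e i k j l →
    A i l * A k j ≤ A i j * A k l
  vecMulVec_mem : ∀ u v, (∀ i, 0 ≤ u i) → (∀ j, 0 ≤ v j) → vecMulVec u v ∈ K
  separating : ∀ i k j l, 0 < cornerSign e i k j l →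
    ∃ A ∈ K, A i l * A k j = 0 ∧ 0 < A i j * A k l

namespace IsSignCone

variable {e : ℝ} {K : Set (Matrix (Fin m) (Fin n) ℝ)}

theorem sign_pos_or (he : e ≠ 0) {i k : Fin m} {j l : Fin n} (hik : i ≠ k) (hjl : j ≠ l) :
    0 < cornerSign e i k j l ∨
      0 < cornerSign e i k l j := by
  have h1 : ((k : ℕ) : ℝ) - (i : ℕ) ≠ 0 := by
    rw [sub_ne_zero]
    exact_mod_cast Fin.val_ne_of_ne hik.symm
  have h2 : ((l : ℕ) : ℝ) - (j : ℕ) ≠ 0 := by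
    rw [sub_ne_zero]
    exact_mod_cast Fin.val_ne_of_ne hjl.symm
  rcases (mul_ne_zero (mul_ne_zero he h1) h2).lt_or_gt with h | h
  · right
    unfold cornerSign
    linarith
  · exact Or.inl h

theorem rectangle_of_sign_pos (hK : IsSignCone e K)
    {f : Matrix (Fin m) (Fin n) ℝ ≃ₗ[ℝ] Matrix (Fin m) (Fin n) ℝ}
    (hg : ∀ A ∈ K, f.symm A ∈ K) {π : Fin m × Fin n → Fin m × Fin n} {c : Fin m × Fin n → ℝ}
    (hπ : Function.Injective π) (hc : ∀ p, 0 < c p)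
    (hf : ∀ A p, f A (π p).1 (π p).2 = c p * A p.1 p.2) {i k : Fin m} {j l : Fin n}
    (hik : i ≠ k) (hjl : j ≠ l)
    (hs : 0 < cornerSign e i k j l) :
    ((π (i, j)).1 = (π (i, l)).1 ∧ (π (k, j)).1 = (π (k, l)).1 ∧
        (π (i, j)).2 = (π (k, j)).2 ∧ (π (i, l)).2 = (π (k, l)).2) ∨
      ((π (i, j)).2 = (π (i, l)).2 ∧ (π (k, j)).2 = (π (k, l)).2 ∧
        (π (i, j)).1 = (π (k, j)).1 ∧ (π (i, l)).1 = (π (k, l)).1) := by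
  classical
  let u : Fin m → ℝ := fun a => if a = (π (i, l)).1 ∨ a = (π (k, j)).1 then 1 else 0
  let v : Fin n → ℝ := fun b => if b = (π (i, l)).2 ∨ b = (π (k, j)).2 then 1 else 0
  have hu : ∀ a, 0 ≤ u a := fun a => by dsimp only [u]; split_ifs <;> norm_num
  have hv : ∀ b, 0 ≤ v b := fun b => by dsimp only [v]; split_ifs <;> norm_num
  set B := f.symm (vecMulVec u v) with hB
  have hBK : B ∈ K := hg _ (hK.vecMulVec_mem u v hu hv)
  have hval : ∀ p, u (π p).1 * v (π p).2 = c p * B p.1 p.2 := by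
    intro p
    rw [← hf, hB, LinearEquiv.apply_symm_apply, vecMulVec_apply]
  have h1 : 0 < B i l := by
    have := hval (i, l)
    simp only [u, v, true_or, if_true, mul_one] at this
    exact (mul_pos_iff_of_pos_left (hc (i, l))).1 (by linarith)
  have h2 : 0 < B k j := by
    have := hval (k, j)
    simp only [u, v, or_true, if_true, mul_one] at this
    exact (mul_pos_iff_of_pos_left (hc (k, j))).1 (by linarith)
  have h3 : 0 < B i j * B k l := (mul_pos h1 h2).trans_le (hK.minor B hBK i k j l hs)
  have hbox : ∀ p : Fin m × Fin n, B p.1 p.2 ≠ 0 →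
      ((π p).1 = (π (i, l)).1 ∨ (π p).1 = (π (k, j)).1) ∧
      ((π p).2 = (π (i, l)).2 ∨ (π p).2 = (π (k, j)).2) := by
    intro p hp
    have h := hval p
    have h' : u (π p).1 * v (π p).2 ≠ 0 := h ▸ mul_ne_zero (hc p).ne' hp
    refine ⟨?_, ?_⟩ <;> by_contra hcon
    · exact h' (by simp [u, hcon])
    · exact h' (by simp [v, hcon])
  have h4 := hbox (i, j) (left_ne_zero_of_mul h3.ne')
  have h5 := hbox (k, l) (right_ne_zero_of_mul h3.ne')
  have hne : ∀ {p q : Fin m × Fin n}, p ≠ q → ¬ ((π p).1 = (π q).1 ∧ (π p).2 = (π q).2) :=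
    fun hpq h => hpq (hπ (Prod.ext h.1 h.2))
  have n1 := hne (p := (i, j)) (q := (i, l)) (by simp [hjl])
  have n2 := hne (p := (i, j)) (q := (k, j)) (by simp [hik])
  have n3 := hne (p := (i, j)) (q := (k, l)) (by simp [hik])
  have n4 := hne (p := (i, l)) (q := (k, j)) (by simp [hik])
  have n5 := hne (p := (i, l)) (q := (k, l)) (by simp [hik])
  have n6 := hne (p := (k, j)) (q := (k, l)) (by simp [hjl])
  grind

theorem rectangle (hK : IsSignCone e K) (he : e ≠ 0)
    {f : Matrix (Fin m) (Fin n) ℝ ≃ₗ[ℝ] Matrix (Fin m) (Fin n) ℝ}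
    (hg : ∀ A ∈ K, f.symm A ∈ K) {π : Fin m × Fin n → Fin m × Fin n} {c : Fin m × Fin n → ℝ}
    (hπ : Function.Injective π) (hc : ∀ p, 0 < c p)
    (hf : ∀ A p, f A (π p).1 (π p).2 = c p * A p.1 p.2) (i k : Fin m) (j l : Fin n)
    (hik : i ≠ k) (hjl : j ≠ l) :
    ((π (i, j)).1 = (π (i, l)).1 ∧ (π (k, j)).1 = (π (k, l)).1 ∧
        (π (i, j)).2 = (π (k, j)).2 ∧ (π (i, l)).2 = (π (k, l)).2) ∨
      ((π (i, j)).2 = (π (i, l)).2 ∧ (π (k, j)).2 = (π (k, l)).2 ∧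
        (π (i, j)).1 = (π (k, j)).1 ∧ (π (i, l)).1 = (π (k, l)).1) := by
  rcases sign_pos_or he hik hjl with h | h
  · exact hK.rectangle_of_sign_pos hg hπ hc hf hik hjl h
  · rcases hK.rectangle_of_sign_pos hg hπ hc hf hik hjl.symm h with H | H
    · exact Or.inl ⟨H.1.symm, H.2.1.symm, H.2.2.2, H.2.2.1⟩
    · exact Or.inr ⟨H.1.symm, H.2.1.symm, H.2.2.2, H.2.2.1⟩

section

variable {f : Matrix (Fin m) (Fin n) ℝ ≃ₗ[ℝ] Matrix (Fin m) (Fin n) ℝ} {c : Fin m × Fin n → ℝ}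
  {σ : Fin m → Fin m} {τ : Fin n → Fin n}

theorem cornerSign_map_pos (hK : IsSignCone e K) (he : e ≠ 0) (hfK : ∀ A ∈ K, f A ∈ K)
    (hc : ∀ p, 0 < c p) (hσ : Function.Injective σ) (hτ : Function.Injective τ)
    (hf : ∀ A i j, f A (σ i) (τ j) = c (i, j) * A i j) {i k : Fin m} {j l : Fin n}
    (hik : i ≠ k) (hjl : j ≠ l) (h : 0 < cornerSign e i k j l) :
    0 < cornerSign e (σ i) (σ k) (τ j) (τ l) := by
  refine (sign_pos_or he (hσ.ne hik) (hτ.ne hjl)).resolve_right fun h' => ?_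
  obtain ⟨A, hA, h0, hpos⟩ := hK.separating i k j l h
  have := hK.minor _ (hfK A hA) _ _ _ _ h'
  rw [hf, hf, hf, hf] at this
  have h1 : c (i, l) * A i l * (c (k, j) * A k j) = 0 := by
    rw [mul_mul_mul_comm, h0, mul_zero]
  have h2 : 0 < c (i, j) * A i j * (c (k, l) * A k l) := by
    rw [mul_mul_mul_comm]
    exact mul_pos (mul_pos (hc _) (hc _)) hpos
  linarith

theorem lt_and_lt_or (hK : IsSignCone e K) (he : e ≠ 0) (hfK : ∀ A ∈ K, f A ∈ K)
    (hc : ∀ p, 0 < c p) (hσ : Function.Injective σ) (hτ : Function.Injective τ)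
    (hf : ∀ A i j, f A (σ i) (τ j) = c (i, j) * A i j) {i k : Fin m} {j l : Fin n}
    (hik : i < k) (hjl : j < l) : (σ i < σ k ∧ τ j < τ l) ∨ (σ k < σ i ∧ τ l < τ j) := by
  have hik' : (0 : ℝ) < ((k : ℕ) : ℝ) - (i : ℕ) := sub_pos.2 (by exact_mod_cast hik)
  have hjl' : (0 : ℝ) < ((l : ℕ) : ℝ) - (j : ℕ) := sub_pos.2 (by exact_mod_cast hjl)
  have key : 0 < (((σ k : ℕ) : ℝ) - (σ i : ℕ)) * (((τ l : ℕ) : ℝ) - (τ j : ℕ)) := by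
    rcases sign_pos_or he hik.ne hjl.ne with h | h
    · have h' := hK.cornerSign_map_pos he hfK hc hσ hτ hf hik.ne hjl.ne h
      unfold cornerSign at h h'
      have hepos : 0 < e := (pos_iff_pos_of_mul_pos (by rwa [mul_assoc] at h)).2 (mul_pos hik' hjl')
      rw [mul_assoc] at h'
      exact (mul_pos_iff_of_pos_left hepos).1 h'
    · have h' := hK.cornerSign_map_pos he hfK hc hσ hτ hf hik.ne hjl.ne' h
      unfold cornerSign at h h'
      have hepos : 0 < -e := by
        refine (pos_iff_pos_of_mul_pos (b := (((k : ℕ) : ℝ) - (i : ℕ)) *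
          (((l : ℕ) : ℝ) - (j : ℕ))) ?_).2 (mul_pos hik' hjl')
        linarith
      refine (mul_pos_iff_of_pos_left hepos).1 ?_
      linarith
  rcases mul_pos_iff.1 key with ⟨h1, h2⟩ | ⟨h1, h2⟩
  · exact Or.inl ⟨by exact_mod_cast sub_pos.1 h1, by exact_mod_cast sub_pos.1 h2⟩
  · exact Or.inr ⟨by exact_mod_cast sub_neg.1 h1, by exact_mod_cast sub_neg.1 h2⟩

theorem eq_id_or_eq_rev (hK : IsSignCone e K) (he : e ≠ 0) (hm : 2 ≤ m) (hn : 2 ≤ n)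
    (hfK : ∀ A ∈ K, f A ∈ K) (hc : ∀ p, 0 < c p) (hσ : Function.Injective σ)
    (hτ : Function.Injective τ) (hf : ∀ A i j, f A (σ i) (τ j) = c (i, j) * A i j) :
    (σ = id ∧ τ = id) ∨ (σ = Fin.rev ∧ τ = Fin.rev) := by
  have key : ∀ {i k : Fin m} {j l : Fin n}, i < k → j < l →
      (σ i < σ k ∧ τ j < τ l) ∨ (σ k < σ i ∧ τ l < τ j) :=
    fun hik hjl => hK.lt_and_lt_or he hfK hc hσ hτ hf hik hjl
  have hanti : ∀ {q : ℕ} {ρ : Fin q → Fin q}, StrictAnti ρ → ρ = Fin.rev := by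
    intro q ρ hρ
    have h : StrictMono (Fin.rev ∘ ρ) := fun a b hab => Fin.rev_lt_rev.2 (hρ hab)
    funext a
    exact Fin.rev_eq_iff.1 (congrFun h.eq_id a)
  have h01m : (⟨0, by omega⟩ : Fin m) < ⟨1, by omega⟩ := by simp
  have h01n : (⟨0, by omega⟩ : Fin n) < ⟨1, by omega⟩ := by simp
  rcases key h01m h01n with ⟨h1, h2⟩ | ⟨h1, h2⟩
  · have hs : StrictMono σ := fun a b hab =>
      ((key hab h01n).resolve_right fun h => lt_asymm h2 h.2).1
    have ht : StrictMono τ := fun a b hab =>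
      ((key h01m hab).resolve_right fun h => lt_asymm h1 h.1).2
    exact Or.inl ⟨hs.eq_id, ht.eq_id⟩
  · have hs : StrictAnti σ := fun a b hab =>
      ((key hab h01n).resolve_left fun h => lt_asymm h2 h.2).1
    have ht : StrictAnti τ := fun a b hab =>
      ((key h01m hab).resolve_left fun h => lt_asymm h1 h.1).2
    exact Or.inr ⟨hanti hs, hanti ht⟩

theorem scale_mul_scale (hK : IsSignCone e K) (he : e ≠ 0) (hfK : ∀ A ∈ K, f A ∈ K)
    (hg : ∀ A ∈ K, f.symm A ∈ K) (hc : ∀ p, 0 < c p) (hσ : Function.Injective σ)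
    (hτ : Function.Injective τ) (hf : ∀ A i j, f A (σ i) (τ j) = c (i, j) * A i j)
    (i k : Fin m) (j l : Fin n) : c (i, l) * c (k, j) = c (i, j) * c (k, l) := by
  rcases eq_or_ne i k with rfl | hik
  · ring
  rcases eq_or_ne j l with rfl | hjl
  · ring
  have hJ : vecMulVec 1 1 ∈ K := hK.vecMulVec_mem 1 1 (by simp) (by simp)
  have hfJ : ∀ i j, f (vecMulVec 1 1) (σ i) (τ j) = c (i, j) := by
    intro i j
    simp [hf]
  have hgJ : ∀ i j, f.symm (vecMulVec 1 1) i j = (c (i, j))⁻¹ := by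
    intro i j
    have := hf (f.symm (vecMulVec 1 1)) i j
    rw [LinearEquiv.apply_symm_apply] at this
    refine eq_inv_of_mul_eq_one_right ?_
    simpa [vecMulVec_apply] using this.symm
  have key : ∀ {j l : Fin n}, j ≠ l → 0 < cornerSign e i k j l →
      c (i, l) * c (k, j) = c (i, j) * c (k, l) := by
    intro j l hjl h
    have h1 := hK.minor _ (hfK _ hJ) _ _ _ _ (hK.cornerSign_map_pos he hfK hc hσ hτ hf hik hjl h)
    have h2 := hK.minor _ (hg _ hJ) _ _ _ _ h
    rw [hfJ, hfJ, hfJ, hfJ] at h1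
    rw [hgJ, hgJ, hgJ, hgJ, ← mul_inv, ← mul_inv,
      inv_le_inv₀ (mul_pos (hc _) (hc _)) (mul_pos (hc _) (hc _))] at h2
    exact le_antisymm h1 h2
  rcases sign_pos_or he hik hjl with h | h
  · exact key hjl h
  · exact (key hjl.symm h).symm

theorem exists_list_of_prod (hK : IsSignCone e K) (he : e ≠ 0) (hm : 2 ≤ m) (hn : 2 ≤ n)
    (hfK : ∀ A ∈ K, f A ∈ K) (hg : ∀ A ∈ K, f.symm A ∈ K) (hc : ∀ p, 0 < c p)
    (hσ : Function.Injective σ) (hτ : Function.Injective τ)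
    (hf : ∀ A i j, f A (σ i) (τ j) = c (i, j) * A i j) :
    ∃ L : List (Matrix (Fin m) (Fin n) ℝ → Matrix (Fin m) (Fin n) ℝ),
      L ≠ [] ∧ (∀ T ∈ L, ElemSSRPatMap m n T) ∧ ⇑f = L.foldr (· ∘ ·) id := by
  let a : Fin m := ⟨0, by omega⟩
  let b : Fin n := ⟨0, by omega⟩
  let u : Fin m → ℝ := fun i => c (i, b)
  let v : Fin n → ℝ := fun j => c (a, j) / c (a, b)
  let D : Matrix (Fin m) (Fin n) ℝ → Matrix (Fin m) (Fin n) ℝ :=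
    fun A => diagonal u * A * diagonal v
  have hD : ElemSSRPatMap m n D :=
    Or.inl ⟨u, v, fun _ => hc _, fun _ => div_pos (hc _) (hc _), rfl⟩
  have hfD : ∀ A i j, f A (σ i) (τ j) = D A i j := by
    intro A i j
    have h := hK.scale_mul_scale he hfK hg hc hσ hτ hf i a j b
    have hab := (hc (a, b)).ne'
    simp only [hf, D, u, v, mul_diagonal, diagonal_mul]
    field_simp
    linear_combination -A i j * h
  rcases hK.eq_id_or_eq_rev he hm hn hfK hc hσ hτ hf with ⟨rfl, rfl⟩ | ⟨rfl, rfl⟩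
  · refine ⟨[D], by simp, by simpa using hD, ?_⟩
    funext A
    ext i j
    exact hfD A i j
  · refine ⟨[fun A => exchangeMat m * A * exchangeMat n, D], by simp, ?_, ?_⟩
    · simpa using ⟨Or.inr (Or.inl rfl), hD⟩
    · funext A
      ext i j
      simp only [List.foldr_cons, List.foldr_nil, Function.comp_apply, id_eq,
        exchangeMat_mul_mul_exchangeMat, submatrix_apply, ← hfD, Fin.rev_rev]

end

theorem single_mem (hK : IsSignCone e K) (i : Fin m) (j : Fin n) : single i j (1 : ℝ) ∈ K := by
  rw [single_eq_single_vecMulVec_single]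
  refine hK.vecMulVec_mem _ _ ?_ ?_
  · exact fun a => (Pi.single_nonneg.2 zero_le_one : (0 : Fin m → ℝ) ≤ Pi.single i 1) a
  · exact fun b => (Pi.single_nonneg.2 zero_le_one : (0 : Fin n → ℝ) ≤ Pi.single j 1) b

/-- Linear automorphisms of a sign cone are compositions of the elementary maps. -/
theorem exists_list (hK : IsSignCone e K) (he : e ≠ 0) (hm : 2 ≤ m) (hn : 2 ≤ n)
    (hT : ∀ T, ElemSSRPatMap m n T → ∀ A ∈ K, T A ∈ K)
    (f : Matrix (Fin m) (Fin n) ℝ ≃ₗ[ℝ] Matrix (Fin m) (Fin n) ℝ)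
    (hfK : ∀ A ∈ K, f A ∈ K) (hg : ∀ A ∈ K, f.symm A ∈ K) :
    ∃ L : List (Matrix (Fin m) (Fin n) ℝ → Matrix (Fin m) (Fin n) ℝ),
      L ≠ [] ∧ (∀ T ∈ L, ElemSSRPatMap m n T) ∧ ⇑f = L.foldr (· ∘ ·) id := by
  have hsingle := fun p : Fin m × Fin n => hK.single_mem p.1 p.2
  obtain ⟨π, c, hπ, hc, hf⟩ := exists_perm_scale f
    (fun p => hK.nonneg _ (hfK _ (hsingle p))) (fun p => hK.nonneg _ (hg _ (hsingle p)))
  have hR := hK.rectangle he hg hπ hc hf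
  have h01m : (⟨0, by omega⟩ : Fin m) ≠ ⟨1, by omega⟩ := by simp
  have h01n : (⟨0, by omega⟩ : Fin n) ≠ ⟨1, by omega⟩ := by simp
  have hinj : ∀ {γ δ : Type} {ρ : Fin m × Fin n → γ × δ} {σ : Fin m → γ} {τ : Fin n → δ},
      Function.Injective ρ → (∀ i j, ρ (i, j) = (σ i, τ j)) →
      Function.Injective σ ∧ Function.Injective τ := by
    intro γ δ ρ σ τ hρ h
    refine ⟨fun i k hik => ?_, fun j l hjl => ?_⟩
    · have : ρ (i, ⟨0, by omega⟩) = ρ (k, ⟨0, by omega⟩) := by rw [h, h, hik]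
      exact congrArg Prod.fst (hρ this)
    · have : ρ (⟨0, by omega⟩, j) = ρ (⟨0, by omega⟩, l) := by rw [h, h, hjl]
      exact congrArg Prod.snd (hρ this)
  rcases hR _ _ _ _ h01m h01n with H | H
  · obtain ⟨σ, τ, hστ⟩ := exists_eq_prod_of_rectangle hπ hR h01m h01n H.1
    obtain ⟨hσ, hτ⟩ := hinj hπ hστ
    refine hK.exists_list_of_prod he hm hn hfK hg hc hσ hτ fun A i j => ?_
    simpa only [hστ] using hf A (i, j)
  · have hπ' : Function.Injective (Prod.swap ∘ π) := Prod.swap_injective.comp hπ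
    obtain ⟨σ, τ, hστ⟩ := exists_eq_prod_of_rectangle hπ'
      (fun i k j l hik hjl => (hR i k j l hik hjl).symm) h01m h01n H.1
    obtain ⟨hσ, hτ⟩ := hinj hπ' hστ
    obtain rfl : m = n := le_antisymm
      (by simpa using Fintype.card_le_of_injective σ hσ)
      (by simpa using Fintype.card_le_of_injective τ hτ)
    have htr : ElemSSRPatMap m m Matrix.transpose := Or.inr (Or.inr ⟨rfl, rfl⟩)
    have hπστ : ∀ i j, π (i, j) = (τ j, σ i) := fun i j => Prod.swap_injective (hστ i j)
    let t := transposeLinearEquiv (Fin m) (Fin m) ℝ ℝ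
    obtain ⟨L, -, hL, hfL⟩ := hK.exists_list_of_prod (f := f.trans t) (c := c) he hm hn
      (fun A hA => hT _ htr _ (hfK A hA)) (fun A hA => hg _ (hT _ htr A hA)) hc hσ hτ
      (fun A i j => by
        have h := hf A (i, j)
        rw [hπστ] at h
        exact h)
    refine ⟨Matrix.transpose :: L, by simp, ?_, ?_⟩
    · simpa using ⟨htr, hL⟩
    · rw [List.foldr_cons, ← hfL]
      rfl

end IsSignCone

section

variable {k : ℕ} {ε : ℕ → ℝ}

theorem nonneg_of_mem_closure (hk : 1 ≤ k) {A : Matrix (Fin m) (Fin n) ℝ}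
    (hA : A ∈ closure {B : Matrix (Fin m) (Fin n) ℝ | IsSSRkPat k ε B}) (i : Fin m) (j : Fin n) :
    0 ≤ ε 1 * A i j := by
  have hC : IsClosed {B : Matrix (Fin m) (Fin n) ℝ | 0 ≤ ε 1 * B i j} :=
    isClosed_le continuous_const (continuous_const.mul (continuous_id.matrix_elem i j))
  refine closure_minimal (fun B hB => ?_) hC hA
  have h := hB 1 le_rfl hk (fun _ => i) (fun _ => j) (Subsingleton.strictMono _)
    (Subsingleton.strictMono _)
  rw [det_fin_one] at h
  exact h.le

theorem minor_nonneg_of_mem_closure (hk : 2 ≤ k) {A : Matrix (Fin m) (Fin n) ℝ}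
    (hA : A ∈ closure {B : Matrix (Fin m) (Fin n) ℝ | IsSSRkPat k ε B}) {i i' : Fin m}
    {j j' : Fin n} (hi : i < i') (hj : j < j') :
    0 ≤ ε 2 * (A i j * A i' j' - A i j' * A i' j) := by
  have hC : IsClosed {B : Matrix (Fin m) (Fin n) ℝ |
      0 ≤ ε 2 * (B i j * B i' j' - B i j' * B i' j)} := by
    refine isClosed_le continuous_const (continuous_const.mul (.sub (.mul ?_ ?_) (.mul ?_ ?_))) <;>
      exact continuous_id.matrix_elem _ _
  refine closure_minimal (fun B hB => ?_) hC hA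
  have h := hB 2 one_le_two hk ![i, i'] ![j, j'] (by simpa using hi) (by simpa using hj)
  rw [det_fin_two] at h
  simpa using h.le

theorem minor_le_of_mem_closure (hk : 2 ≤ k) {A : Matrix (Fin m) (Fin n) ℝ}
    (hA : A ∈ closure {B : Matrix (Fin m) (Fin n) ℝ | IsSSRkPat k ε B}) {i i' : Fin m}
    {j j' : Fin n} (h : 0 < cornerSign (ε 2) i i' j j') : A i j' * A i' j ≤ A i j * A i' j' := by
  have key : 0 ≤ cornerSign (ε 2) i i' j j' * (A i j * A i' j' - A i j' * A i' j) := by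
    unfold cornerSign
    have hpos : ∀ {q : ℕ} {a b : Fin q}, a < b → (0 : ℝ) < ((b : ℕ) : ℝ) - (a : ℕ) :=
      fun hab => sub_pos.2 (by exact_mod_cast hab)
    rcases lt_trichotomy i i' with hi | rfl | hi
    · rcases lt_trichotomy j j' with hj | rfl | hj
      · have := mul_nonneg (mul_pos (hpos hi) (hpos hj)).le (minor_nonneg_of_mem_closure hk hA hi hj)
        linarith
      · simp
      · have := mul_nonneg (mul_pos (hpos hi) (hpos hj)).le (minor_nonneg_of_mem_closure hk hA hi hj)
        linarith
    · simp
    · rcases lt_trichotomy j j' with hj | rfl | hj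
      · have := mul_nonneg (mul_pos (hpos hi) (hpos hj)).le (minor_nonneg_of_mem_closure hk hA hi hj)
        linarith
      · simp
      · have := mul_nonneg (mul_pos (hpos hi) (hpos hj)).le (minor_nonneg_of_mem_closure hk hA hi hj)
        linarith
  exact sub_nonneg.1 ((mul_nonneg_iff_of_pos_left h).1 key)

theorem isSignCone_closure (hk : 2 ≤ k) (hε : ∀ s, 1 ≤ s → s ≤ k → ε s = 1 ∨ ε s = -1) :
    IsSignCone (ε 2)
      {A | ε 1 • A ∈ closure {B : Matrix (Fin m) (Fin n) ℝ | IsSSRkPat k ε B}} := by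
  have h1 : ε 1 * ε 1 = 1 := by
    rcases hε 1 le_rfl (by omega) with h | h <;> simp [h]
  have hker : ∀ {x : Fin m → ℝ} {y : Fin n → ℝ} {u : Fin m → ℝ} {v : Fin n → ℝ},
      (∀ i, 0 ≤ u i) → (∀ j, 0 ≤ v j) → Monotone x → Monotone y →
      (∀ i j, 0 ≤ 1 + ε 2 * (x i * y j)) →
      ε 1 • bilinearKernel 1 (ε 2) u x v y ∈
        closure {B : Matrix (Fin m) (Fin n) ℝ | IsSSRkPat k ε B} := by
    intro x y u v hu hv hx hy hxy
    convert bilinearKernel_mem_closure hk hε hu hv hx hy hxy using 1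
    ext i j
    simp [bilinearKernel]
  refine ⟨fun A hA i j => ?_, fun A hA i i' j j' h => ?_, fun u v hu hv => ?_, ?_⟩
  · have := nonneg_of_mem_closure (by omega) hA i j
    simpa [← mul_assoc, h1] using this
  · have := minor_le_of_mem_closure hk hA h
    simp only [Matrix.smul_apply, smul_eq_mul] at this
    rwa [mul_mul_mul_comm, mul_mul_mul_comm (ε 1) (A i j), h1, one_mul, one_mul] at this
  · have := hker (x := 0) (y := 0) hu hv monotone_const monotone_const (by simp)
    have h : bilinearKernel 1 (ε 2) u 0 v 0 = vecMulVec u v := by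
      ext i j
      simp [bilinearKernel, vecMulVec_apply]
    rwa [h] at this
  · have key : ∀ {i i' : Fin m} {j j' : Fin n}, i < i' → 0 < cornerSign (ε 2) i i' j j' →
        ∃ A : Matrix (Fin m) (Fin n) ℝ,
          ε 1 • A ∈ closure {B : Matrix (Fin m) (Fin n) ℝ | IsSSRkPat k ε B} ∧
          A i j' * A i' j = 0 ∧ 0 < A i j * A i' j' := by
      intro i i' j j' hi h
      have hi' : (0 : ℝ) < ((i' : ℕ) : ℝ) - (i : ℕ) := sub_pos.2 (by exact_mod_cast hi)
      unfold cornerSign at h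
      have hx : Monotone fun a : Fin m => if a ≤ i then (-1 : ℝ) else 0 := by
        intro a b hab
        dsimp only
        split_ifs <;> first | (exfalso; omega) | norm_num
      rcases hε 2 one_le_two hk with h2 | h2
      · have hj : j < j' := by
          have : (0 : ℝ) < ((j' : ℕ) : ℝ) - (j : ℕ) := by
            rw [h2, one_mul] at h
            exact (mul_pos_iff_of_pos_left hi').1 h
          exact_mod_cast sub_pos.1 this
        refine ⟨_, hker (u := 1) (v := 1) (by simp) (by simp) hx
          (y := fun b => if b < j' then 0 else 1) (fun a b hab => ?_) (fun a b => ?_), ?_, ?_⟩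
        · dsimp only
          split_ifs <;> first | (exfalso; omega) | norm_num
        · rw [h2]
          split_ifs <;> norm_num
        · simp [bilinearKernel, h2]
        · simp [bilinearKernel, hj, hi.not_ge]
      · have hj : j' < j := by
          have : (0 : ℝ) < ((j : ℕ) : ℝ) - (j' : ℕ) := by
            refine (mul_pos_iff_of_pos_left hi').1 ?_
            rw [h2] at h
            linarith
          exact_mod_cast sub_pos.1 this
        refine ⟨_, hker (u := 1) (v := 1) (by simp) (by simp) hx
          (y := fun b => if b ≤ j' then -1 else 0) (fun a b hab => ?_) (fun a b => ?_), ?_, ?_⟩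
        · dsimp only
          split_ifs <;> first | (exfalso; omega) | norm_num
        · rw [h2]
          split_ifs <;> norm_num
        · simp [bilinearKernel, h2]
        · simp [bilinearKernel, hj.not_ge, hi.not_ge]
    intro i i' j j' h
    rcases lt_trichotomy i i' with hi | rfl | hi
    · exact key hi h
    · simp [cornerSign] at h
    · obtain ⟨A, hA, h0, hpos⟩ := key (j := j') (j' := j) hi (by unfold cornerSign at h ⊢; linarith)
      exact ⟨A, hA, by rwa [mul_comm], by rwa [mul_comm]⟩

end

theorem ElemSSRPatMap.continuous {T : Matrix (Fin m) (Fin n) ℝ → Matrix (Fin m) (Fin n) ℝ}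
    (hT : ElemSSRPatMap m n T) : Continuous T := by
  rcases hT with ⟨u, v, -, -, rfl⟩ | rfl | ⟨rfl, rfl⟩
  · fun_prop
  · fun_prop
  · exact continuous_id.matrix_transpose

theorem ElemSSRPatMap.map_smul {T : Matrix (Fin m) (Fin n) ℝ → Matrix (Fin m) (Fin n) ℝ}
    (hT : ElemSSRPatMap m n T) (c : ℝ) (A : Matrix (Fin m) (Fin n) ℝ) : T (c • A) = c • T A := by
  rcases hT with ⟨u, v, -, -, rfl⟩ | rfl | ⟨rfl, rfl⟩
  · simp
  · simp
  · rfl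

/-- Linear maps of the SSR matrices of a given pattern onto themselves are compositions of the
elementary maps. -/
theorem exists_list_of_image_eq (hm : 2 ≤ m) (hn : 2 ≤ n) {k : ℕ} (hk : 2 ≤ k) {ε : ℕ → ℝ}
    (hε : ∀ s, 1 ≤ s → s ≤ k → ε s = 1 ∨ ε s = -1)
    (𝓛 : Matrix (Fin m) (Fin n) ℝ →ₗ[ℝ] Matrix (Fin m) (Fin n) ℝ)
    (h𝓛 : ⇑𝓛 '' {A | IsSSRkPat k ε A} = {A | IsSSRkPat k ε A}) :
    ∃ L : List (Matrix (Fin m) (Fin n) ℝ → Matrix (Fin m) (Fin n) ℝ),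
      L ≠ [] ∧ (∀ T ∈ L, ElemSSRPatMap m n T) ∧ ⇑𝓛 = L.foldr (· ∘ ·) id := by
  have hK := isSignCone_closure (m := m) (n := n) hk hε
  have h1 : ε 1 ≠ 0 := by
    rcases hε 1 le_rfl (by omega) with h | h <;> simp [h]
  have h2 : ε 2 ≠ 0 := by
    rcases hε 2 one_le_two hk with h | h <;> simp [h]
  have hrange : closure {A | IsSSRkPat k ε A} ⊆
      (LinearMap.range 𝓛 : Set (Matrix (Fin m) (Fin n) ℝ)) := by
    refine closure_minimal ?_ (Submodule.closed_of_finiteDimensional _)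
    rw [← h𝓛]
    exact Set.image_subset_range _ _
  have hsurj : Function.Surjective 𝓛 := by
    rw [← LinearMap.range_eq_top, eq_top_iff]
    intro A _
    rw [matrix_eq_sum_single A]
    refine Submodule.sum_mem _ fun i _ => Submodule.sum_mem _ fun j _ => ?_
    have h : single i j (A i j) = (A i j * (ε 1)⁻¹) • ε 1 • single i j (1 : ℝ) := by
      simp [smul_single, h1]
    rw [h]
    exact Submodule.smul_mem _ _ (hrange (hK.single_mem i j))
  let f := LinearEquiv.ofBijective 𝓛 ⟨LinearMap.injective_iff_surjective.2 hsurj, hsurj⟩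
  refine hK.exists_list h2 hm hn (fun T hT A hA => ?_) f (fun A hA => ?_) (fun A hA => ?_)
  · have := map_mem_closure (t := {A | IsSSRkPat k ε A}) hT.continuous hA
      fun B hB => hT.isSSRkPat hB
    rwa [hT.map_smul] at this
  · have := map_mem_closure (LinearMap.continuous_of_finiteDimensional 𝓛) hA
      fun B hB => h𝓛.subset (Set.mem_image_of_mem _ hB)
    rwa [map_smul] at this
  · have hf : Set.MapsTo f.symm {A | IsSSRkPat k ε A} {A | IsSSRkPat k ε A} := by
      intro B hB
      obtain ⟨C, hC, rfl⟩ := h𝓛.superset hB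
      exact (f.symm_apply_apply C).symm ▸ hC
    have := map_mem_closure (LinearMap.continuous_of_finiteDimensional f.symm.toLinearMap) hA hf
    rwa [LinearEquiv.coe_coe, map_smul] at this

end

/-- for `m, n ≥ 2` and a sign pattern `ε ∈ {1,-1}^{min m n}`, a
linear map `𝓛 : ℝ^{m×n} → ℝ^{m×n}` maps the SSR(ε) matrices onto themselves iff
it maps the SSR₂((ε₁,ε₂)) matrices onto themselves, iff it is a composition of
one or more of the transformations (a)–(c). -/
theorem ssr_pattern_linear_preserver (m n : ℕ) (hm : 2 ≤ m) (hn : 2 ≤ n)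
    (ε : ℕ → ℝ) (hε : ∀ r : ℕ, 1 ≤ r → r ≤ min m n → ε r = 1 ∨ ε r = -1)
    (𝓛 : Matrix (Fin m) (Fin n) ℝ →ₗ[ℝ] Matrix (Fin m) (Fin n) ℝ) :
    ((⇑𝓛 '' {A | IsSSRkPat (min m n) ε A} = {A | IsSSRkPat (min m n) ε A}) ↔
      (⇑𝓛 '' {A | IsSSRkPat 2 ε A} = {A | IsSSRkPat 2 ε A})) ∧
    ((⇑𝓛 '' {A | IsSSRkPat 2 ε A} = {A | IsSSRkPat 2 ε A}) ↔
      (∃ L : List (Matrix (Fin m) (Fin n) ℝ → Matrix (Fin m) (Fin n) ℝ),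
        L ≠ [] ∧ (∀ T ∈ L, ElemSSRPatMap m n T) ∧ ⇑𝓛 = L.foldr (· ∘ ·) id)) := by
  have iff_of_le : ∀ k, 2 ≤ k → k ≤ min m n →
      ((⇑𝓛 '' {A | IsSSRkPat k ε A} = {A | IsSSRkPat k ε A}) ↔
        (∃ L : List (Matrix (Fin m) (Fin n) ℝ → Matrix (Fin m) (Fin n) ℝ),
          L ≠ [] ∧ (∀ T ∈ L, ElemSSRPatMap m n T) ∧ ⇑𝓛 = L.foldr (· ∘ ·) id)) := by
    refine fun k hk hkmn => ⟨exists_list_of_image_eq hm hn hk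
      (fun s hs hsk => hε s hs (hsk.trans hkmn)) 𝓛, ?_⟩
    rintro ⟨L, -, hL, h⟩
    rw [h, image_foldr_comp_setOf_isSSRkPat hL]
  have h2 : 2 ≤ min m n := le_min hm hn
  exact ⟨(iff_of_le _ h2 le_rfl).trans (iff_of_le 2 le_rfl h2).symm, iff_of_le 2 le_rfl h2⟩
end

section
/- Given integers m, n ≥ k ≥ 1 and a sign pattern ε = (ε_1,…,ε_k) ∈ {1,−1}^k, the set of m×n SSR_k(ε) matrices is dense in the set of m×n SR_k(ε) matrices (with respect to the standard topology on ℝ^{m×n}): every SR_k(ε) matrix is a limit of SSR_k(ε) matrices. -/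
open Matrix

/-- `A` is sign regular of order `k` with sign pattern `ε` (SRₖ(ε)): for each
`1 ≤ r ≤ k`, every nonzero `r × r` minor of `A` has sign `ε r`. -/
def IsSRkPat {m n : ℕ} (k : ℕ) (ε : ℕ → ℝ) (A : Matrix (Fin m) (Fin n) ℝ) : Prop :=
  ∀ r : ℕ, 1 ≤ r → r ≤ k →
    ∀ (f : Fin r → Fin m) (g : Fin r → Fin n),
      StrictMono f → StrictMono g →
      (A.submatrix f g).det ≠ 0 → 0 < ε r * (A.submatrix f g).det

section TotallyPositive

/-- All minors of `G` with increasing rows and columns are positive. -/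
def IsStrictlyTotallyPositive {m n : ℕ} (G : Matrix (Fin m) (Fin n) ℝ) : Prop :=
  ∀ (r : ℕ) (f : Fin r → Fin m) (g : Fin r → Fin n),
    StrictMono f → StrictMono g → 0 < (G.submatrix f g).det

theorem IsStrictlyTotallyPositive.transpose {m n : ℕ} {G : Matrix (Fin m) (Fin n) ℝ}
    (hG : IsStrictlyTotallyPositive G) : IsStrictlyTotallyPositive Gᵀ := by
  intro r f g hf hg
  rw [← transpose_submatrix, det_transpose]
  exact hG r g f hg hf

/-- The determinant expressed through the Schur complement of the top left entry. -/
theorem det_eq_mul_det_schur {K : Type*} [Field K] {r : ℕ}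
    (M : Matrix (Fin (r + 1)) (Fin (r + 1)) K) (h : M 0 0 ≠ 0) :
    M.det = M 0 0 *
      (of fun i j : Fin r => M i.succ j.succ - M i.succ 0 / M 0 0 * M 0 j.succ).det := by
  let N : Matrix (Fin (r + 1)) (Fin (r + 1)) K :=
    of fun i j => if i = 0 then M i j else M i j - M i 0 / M 0 0 * M 0 j
  have hMN : M.det = N.det := by
    refine det_eq_of_forall_row_eq_smul_add_const
      (fun i => if i = 0 then 0 else M i 0 / M 0 0) 0 (by simp) ?_
    intro i j
    by_cases hi : i = 0 <;> simp [N, hi]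
  rw [hMN, det_succ_column_zero, Fin.sum_univ_succ, Finset.sum_eq_zero]
  · simp only [N, of_apply, Fin.val_zero, pow_zero, if_true, one_mul, add_zero]
    congr 2
  · intro i _
    simp [N, Fin.succ_ne_zero, h]

/-- Cauchy matrices with increasing positive parameters have positive determinant. -/
theorem det_cauchy_pos : ∀ (r : ℕ) (x y : Fin r → ℝ), (∀ i, 0 < x i) → (∀ i, 0 < y i) →
    StrictMono x → StrictMono y → 0 < (of fun i j => (x i + y j)⁻¹).det
  | 0, _, _, _, _, _, _ => by simp
  | r + 1, x, y, hx, hy, hxm, hym => by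
    have hp : ∀ i j, 0 < x i + y j := fun i j => add_pos (hx i) (hy j)
    have h00 : (of fun i j => (x i + y j)⁻¹) 0 0 ≠ 0 := by
      simpa using (hp 0 0).ne'
    rw [det_eq_mul_det_schur _ h00]
    have hE : (of fun i j : Fin r =>
          (of fun i j => (x i + y j)⁻¹) i.succ j.succ -
            (of fun i j => (x i + y j)⁻¹) i.succ 0 / (of fun i j => (x i + y j)⁻¹) 0 0 *
              (of fun i j => (x i + y j)⁻¹) 0 j.succ) =
        of fun i j : Fin r => ((x i.succ - x 0) / (x i.succ + y 0)) *
          (of fun i j : Fin r => ((y j.succ - y 0) / (x 0 + y j.succ)) *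
            (of fun i j : Fin r => (x i.succ + y j.succ)⁻¹) i j) i j := by
      ext i j
      have h1 := (hp i.succ j.succ).ne'
      have h2 := (hp i.succ 0).ne'
      have h3 := (hp 0 j.succ).ne'
      have h4 := (hp 0 0).ne'
      simp only [of_apply]
      field_simp
      ring
    rw [hE, det_mul_column, det_mul_row]
    refine mul_pos (by simpa using hp 0 0) (mul_pos (Finset.prod_pos fun i _ => ?_)
      (mul_pos (Finset.prod_pos fun i _ => ?_) ?_))
    · exact div_pos (sub_pos.2 (hxm (Fin.succ_pos i))) (hp _ _)
    · exact div_pos (sub_pos.2 (hym (Fin.succ_pos i))) (hp _ _)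
    · exact det_cauchy_pos r (fun i => x i.succ) (fun i => y i.succ) (fun i => hx _)
        (fun i => hy _) (fun i j hij => hxm (Fin.succ_lt_succ_iff.2 hij))
        (fun i j hij => hym (Fin.succ_lt_succ_iff.2 hij))

/-- A scaled Cauchy matrix that tends to the identity as `t → ∞`. -/
noncomputable def scaledCauchy (n : ℕ) (t : ℝ) : Matrix (Fin n) (Fin n) ℝ :=
  of fun i j => 2 * t ^ (i : ℕ) * (t ^ (j : ℕ) * ((t ^ 2) ^ (i : ℕ) + (t ^ 2) ^ (j : ℕ))⁻¹)

theorem isStrictlyTotallyPositive_scaledCauchy (n : ℕ) {t : ℝ} (ht : 1 < t) :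
    IsStrictlyTotallyPositive (scaledCauchy n t) := by
  intro r f g hf hg
  have ht0 : 0 < t := by linarith
  have ht2 : 1 < t ^ 2 := one_lt_pow₀ ht (by norm_num)
  have hE : (scaledCauchy n t).submatrix f g =
      of fun i j => (2 * t ^ (f i : ℕ)) * (of fun i j => t ^ (g j : ℕ) *
        (of fun i j => ((t ^ 2) ^ (f i : ℕ) + (t ^ 2) ^ (g j : ℕ))⁻¹) i j) i j := by
    ext i j
    simp [scaledCauchy]
  rw [hE, det_mul_column, det_mul_row]
  refine mul_pos (Finset.prod_pos fun i _ => by positivity)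
    (mul_pos (Finset.prod_pos fun i _ => by positivity)
      (det_cauchy_pos r _ _ (fun i => by positivity) (fun i => by positivity) ?_ ?_))
  · exact fun i j hij => pow_lt_pow_right₀ ht2 (hf hij)
  · exact fun i j hij => pow_lt_pow_right₀ ht2 (hg hij)

theorem tendsto_scaledCauchy (n : ℕ) :
    Filter.Tendsto (scaledCauchy n) Filter.atTop (nhds 1) := by
  refine tendsto_pi_nhds.2 fun i => tendsto_pi_nhds.2 fun j => ?_
  by_cases hij : i = j
  · subst hij
    rw [one_apply_eq]
    refine tendsto_const_nhds.congr' ?_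
    filter_upwards [Filter.eventually_gt_atTop 0] with t ht
    simp only [scaledCauchy, of_apply]
    have : t ^ (i : ℕ) ≠ 0 := by positivity
    rw [pow_right_comm]
    field_simp
    norm_num
  · rw [one_apply_ne hij]
    have h2 : Filter.Tendsto (fun t : ℝ => 2 / t) Filter.atTop (nhds 0) :=
      Filter.Tendsto.const_div_atTop Filter.tendsto_id 2
    refine tendsto_of_tendsto_of_tendsto_of_le_of_le' tendsto_const_nhds h2 ?_ ?_
    · filter_upwards [Filter.eventually_gt_atTop 0] with t ht
      simp only [scaledCauchy, of_apply]
      positivity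
    · filter_upwards [Filter.eventually_gt_atTop 1] with t ht
      have ht0 : 0 < t := by linarith
      simp only [scaledCauchy, of_apply]
      rw [← mul_assoc, ← div_eq_mul_inv, div_le_div_iff₀ (by positivity) ht0, mul_assoc 2,
        mul_assoc 2, ← pow_add, ← pow_succ, ← pow_mul, ← pow_mul]
      refine mul_le_mul_of_nonneg_left ?_ zero_le_two
      have hne : (i : ℕ) ≠ j := fun h => hij (Fin.ext h)
      rcases hne.lt_or_gt with h | h
      · have : t ^ ((i : ℕ) + j + 1) ≤ t ^ (2 * (j : ℕ)) := pow_le_pow_right₀ ht.le (by omega)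
        have : 0 < t ^ (2 * (i : ℕ)) := by positivity
        linarith
      · have : t ^ ((i : ℕ) + j + 1) ≤ t ^ (2 * (i : ℕ)) := pow_le_pow_right₀ ht.le (by omega)
        have : 0 < t ^ (2 * (j : ℕ)) := by positivity
        linarith

end TotallyPositive

section CauchyBinet

theorem det_submatrix_mul_eq_sum {R : Type*} [CommRing R] {m n p r : ℕ}
    (G : Matrix (Fin m) (Fin n) R) (A : Matrix (Fin n) (Fin p) R)
    (f : Fin r → Fin m) (g : Fin r → Fin p) :
    ((G * A).submatrix f g).det =
      ∑ h : Fin r → Fin n, (∏ i, G (f i) (h i)) * (A.submatrix h g).det := by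
  have hrow : (G * A).submatrix f g =
      fun i => ∑ l : Fin n, G (f i) l • fun j => A l (g j) := by
    ext i j
    simp [mul_apply, Finset.sum_apply]
  have := (detRowAlternating (R := R) (n := Fin r)).toMultilinearMap.map_sum
    (fun i l => G (f i) l • fun j => A l (g j))
  rw [hrow]
  refine this.trans (Finset.sum_congr rfl fun h _ => ?_)
  exact (detRowAlternating (R := R) (n := Fin r)).toMultilinearMap.map_smul_univ
    (fun i => G (f i) (h i)) fun i j => A (h i) (g j)

/-- The Cauchy-Binet formula, summed over all (not just increasing) index tuples. -/
theorem factorial_mul_det_submatrix_mul {R : Type*} [CommRing R] {m n p r : ℕ}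
    (G : Matrix (Fin m) (Fin n) R) (A : Matrix (Fin n) (Fin p) R)
    (f : Fin r → Fin m) (g : Fin r → Fin p) :
    (r.factorial : R) * ((G * A).submatrix f g).det =
      ∑ h : Fin r → Fin n, (G.submatrix f h).det * (A.submatrix h g).det := by
  have hσ (σ : Equiv.Perm (Fin r)) : ((G * A).submatrix f g).det =
      ∑ h : Fin r → Fin n, ((Equiv.Perm.sign σ : ℤ) : R) * (∏ i, G (f i) (h (σ i))) *
        (A.submatrix h g).det := by
    rw [det_submatrix_mul_eq_sum, ← (σ.arrowCongr (Equiv.refl (Fin n))).symm.sum_comp]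
    refine Finset.sum_congr rfl fun h _ => ?_
    have : A.submatrix ((σ.arrowCongr (Equiv.refl (Fin n))).symm h) g =
        (A.submatrix h g).submatrix σ id := rfl
    rw [this, det_permute]
    simp only [Equiv.arrowCongr_symm, Equiv.arrowCongr_apply, Equiv.refl_symm, Equiv.coe_refl,
      Equiv.symm_symm, Function.comp_apply, id_eq]
    ring
  have hsum : ∑ _σ : Equiv.Perm (Fin r), ((G * A).submatrix f g).det =
      (r.factorial : R) * ((G * A).submatrix f g).det := by
    simp [Fintype.card_perm]
  rw [← hsum, Finset.sum_congr rfl fun σ _ => hσ σ, Finset.sum_comm]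
  refine Finset.sum_congr rfl fun h _ => ?_
  rw [← Finset.sum_mul, ← det_transpose (G.submatrix f h), det_apply' (G.submatrix f h)ᵀ]
  rfl

/-- A product of two minors over a common index tuple is zero or can be computed with the tuple
sorted. -/
theorem det_mul_det_eq_zero_or_strictMono {R : Type*} [CommRing R] {m n p r : ℕ}
    (G : Matrix (Fin m) (Fin n) R) (A : Matrix (Fin n) (Fin p) R)
    (f : Fin r → Fin m) (g : Fin r → Fin p) (h : Fin r → Fin n) :
    (G.submatrix f h).det * (A.submatrix h g).det = 0 ∨
      ∃ h' : Fin r → Fin n, StrictMono h' ∧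
        (G.submatrix f h).det * (A.submatrix h g).det =
          (G.submatrix f h').det * (A.submatrix h' g).det := by
  by_cases hinj : Function.Injective h
  · refine Or.inr ⟨h ∘ Tuple.sort h,
      (Tuple.monotone_sort h).strictMono_of_injective (hinj.comp (Tuple.sort h).injective), ?_⟩
    have h1 : G.submatrix f (h ∘ Tuple.sort h) =
        (G.submatrix f h).submatrix id (Tuple.sort h) := rfl
    have h2 : A.submatrix (h ∘ Tuple.sort h) g =
        (A.submatrix h g).submatrix (Tuple.sort h) id := rfl
    rw [h1, h2, det_permute, det_permute']
    have h3 : ((Equiv.Perm.sign (Tuple.sort h) : ℤ) : R) *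
        ((Equiv.Perm.sign (Tuple.sort h) : ℤ) : R) = 1 := by
      rw [← Int.cast_mul, ← Units.val_mul, Int.units_mul_self]
      simp
    linear_combination (-(G.submatrix f h).det * (A.submatrix h g).det) * h3
  · left
    simp only [Function.Injective, not_forall] at hinj
    obtain ⟨a, b, hab, hne⟩ := hinj
    rw [det_zero_of_row_eq (M := A.submatrix h g) hne (by ext j; simp [hab]), mul_zero]

theorem factorial_mul_term_nonneg {m n p r : ℕ}
    {G : Matrix (Fin m) (Fin n) ℝ} {A : Matrix (Fin n) (Fin p) ℝ} {c : ℝ}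
    (hG : IsStrictlyTotallyPositive G) {f : Fin r → Fin m} {g : Fin r → Fin p}
    (hf : StrictMono f)
    (hA : ∀ h : Fin r → Fin n, StrictMono h → 0 ≤ c * (A.submatrix h g).det)
    (h : Fin r → Fin n) :
    0 ≤ c * ((G.submatrix f h).det * (A.submatrix h g).det) := by
  rcases det_mul_det_eq_zero_or_strictMono G A f g h with h0 | ⟨h', hh', h0⟩
  · simp [h0]
  · rw [h0, mul_left_comm]
    exact mul_nonneg (hG r f h' hf hh').le (hA h' hh')

theorem nonneg_det_submatrix_mul {m n p r : ℕ}
    {G : Matrix (Fin m) (Fin n) ℝ} {A : Matrix (Fin n) (Fin p) ℝ} {c : ℝ}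
    (hG : IsStrictlyTotallyPositive G) {f : Fin r → Fin m} {g : Fin r → Fin p}
    (hf : StrictMono f)
    (hA : ∀ h : Fin r → Fin n, StrictMono h → 0 ≤ c * (A.submatrix h g).det) :
    0 ≤ c * ((G * A).submatrix f g).det := by
  have hr : (0 : ℝ) < r.factorial := by exact_mod_cast r.factorial_pos
  refine nonneg_of_mul_nonneg_right (b := c * ((G * A).submatrix f g).det) ?_ hr
  rw [mul_left_comm, factorial_mul_det_submatrix_mul, Finset.mul_sum]
  exact Finset.sum_nonneg fun h _ => factorial_mul_term_nonneg hG hf hA h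

theorem pos_det_submatrix_mul {m n p r : ℕ}
    {G : Matrix (Fin m) (Fin n) ℝ} {A : Matrix (Fin n) (Fin p) ℝ} {c : ℝ}
    (hG : IsStrictlyTotallyPositive G) {f : Fin r → Fin m} {g : Fin r → Fin p}
    (hf : StrictMono f)
    (hA : ∀ h : Fin r → Fin n, StrictMono h → 0 ≤ c * (A.submatrix h g).det)
    {h : Fin r → Fin n} (hh : StrictMono h) (hpos : 0 < c * (A.submatrix h g).det) :
    0 < c * ((G * A).submatrix f g).det := by
  have hr : (0 : ℝ) < r.factorial := by exact_mod_cast r.factorial_pos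
  refine pos_of_mul_pos_right (b := c * ((G * A).submatrix f g).det) ?_ hr.le
  rw [mul_left_comm, factorial_mul_det_submatrix_mul, Finset.mul_sum]
  refine Finset.sum_pos' (fun h _ => factorial_mul_term_nonneg hG hf hA h)
    ⟨h, Finset.mem_univ h, ?_⟩
  rw [mul_left_comm]
  exact mul_pos (hG r f h hf hh) hpos

theorem det_submatrix_mul_eq_transpose {R : Type*} [CommRing R] {m n p r : ℕ}
    (A : Matrix (Fin m) (Fin n) R) (H : Matrix (Fin n) (Fin p) R)
    (f : Fin r → Fin m) (g : Fin r → Fin p) :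
    ((A * H).submatrix f g).det = ((Hᵀ * Aᵀ).submatrix g f).det := by
  rw [← transpose_mul, ← transpose_submatrix, det_transpose]

theorem nonneg_det_submatrix_mul_mul {m n r : ℕ}
    {G : Matrix (Fin m) (Fin m) ℝ} {A : Matrix (Fin m) (Fin n) ℝ} {H : Matrix (Fin n) (Fin n) ℝ}
    {c : ℝ} (hG : IsStrictlyTotallyPositive G) (hH : IsStrictlyTotallyPositive H)
    (hA : ∀ (f : Fin r → Fin m) (g : Fin r → Fin n), StrictMono f → StrictMono g →
      0 ≤ c * (A.submatrix f g).det)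
    {f : Fin r → Fin m} {g : Fin r → Fin n} (hf : StrictMono f) (hg : StrictMono g) :
    0 ≤ c * ((G * A * H).submatrix f g).det := by
  rw [det_submatrix_mul_eq_transpose]
  refine nonneg_det_submatrix_mul hH.transpose hg fun h hh => ?_
  rw [← transpose_submatrix, det_transpose]
  exact nonneg_det_submatrix_mul hG hf fun h' hh' => hA h' h hh' hh

theorem pos_det_submatrix_mul_mul {m n r : ℕ}
    {G : Matrix (Fin m) (Fin m) ℝ} {A : Matrix (Fin m) (Fin n) ℝ} {H : Matrix (Fin n) (Fin n) ℝ}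
    {c : ℝ} (hG : IsStrictlyTotallyPositive G) (hH : IsStrictlyTotallyPositive H)
    (hA : ∀ (f : Fin r → Fin m) (g : Fin r → Fin n), StrictMono f → StrictMono g →
      0 ≤ c * (A.submatrix f g).det)
    {f₀ : Fin r → Fin m} {g₀ : Fin r → Fin n} (hf₀ : StrictMono f₀) (hg₀ : StrictMono g₀)
    (hpos : 0 < c * (A.submatrix f₀ g₀).det)
    {f : Fin r → Fin m} {g : Fin r → Fin n} (hf : StrictMono f) (hg : StrictMono g) :
    0 < c * ((G * A * H).submatrix f g).det := by
  rw [det_submatrix_mul_eq_transpose]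
  refine pos_det_submatrix_mul hH.transpose hg (fun h hh => ?_) hg₀ ?_
  · rw [← transpose_submatrix, det_transpose]
    exact nonneg_det_submatrix_mul hG hf fun h' hh' => hA h' h hh' hh
  · rw [← transpose_submatrix, det_transpose]
    exact pos_det_submatrix_mul hG hf (fun h' hh' => hA h' g₀ hh' hg₀) hf₀ hpos

end CauchyBinet

section Corner

/-- The matrix with top left entry `t` and all other entries zero. -/
def cornerMatrix (m n : ℕ) (t : ℝ) : Matrix (Fin m) (Fin n) ℝ :=
  of fun i j => if (i : ℕ) = 0 ∧ (j : ℕ) = 0 then t else 0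

theorem det_add_single_zero_zero {R : Type*} [CommRing R] {p : ℕ}
    (M : Matrix (Fin (p + 1)) (Fin (p + 1)) R) (c : R) :
    (M + single 0 0 c).det = M.det + c * (M.submatrix Fin.succ Fin.succ).det := by
  have hsub (j : Fin (p + 1)) : (M + single 0 0 c).submatrix Fin.succ j.succAbove =
      M.submatrix Fin.succ j.succAbove := by
    ext a b
    simp [(Fin.succ_ne_zero _).symm]
  rw [det_succ_row_zero, det_succ_row_zero M]
  simp only [hsub]
  rw [Fin.sum_univ_succ, Fin.sum_univ_succ]
  simp [(Fin.succ_ne_zero _).symm]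
  ring

theorem det_submatrix_add_corner {m n p : ℕ} (B : Matrix (Fin m) (Fin n) ℝ) (t : ℝ)
    {f : Fin (p + 1) → Fin m} {g : Fin (p + 1) → Fin n} (hf : StrictMono f) (hg : StrictMono g) :
    ((B + cornerMatrix m n t).submatrix f g).det = (B.submatrix f g).det +
      (if (f 0 : ℕ) = 0 ∧ (g 0 : ℕ) = 0 then t else 0) *
        (B.submatrix (f ∘ Fin.succ) (g ∘ Fin.succ)).det := by
  have hval {l : ℕ} {u : Fin (p + 1) → Fin l} (hu : StrictMono u) (i : Fin (p + 1)) :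
      (u i : ℕ) = 0 ↔ i = 0 ∧ (u 0 : ℕ) = 0 := by
    constructor
    · intro h
      have hi : i = 0 := by
        by_contra hne
        have : (u 0 : ℕ) < u i := hu (Fin.pos_iff_ne_zero.2 hne)
        omega
      exact ⟨hi, hi ▸ h⟩
    · rintro ⟨rfl, h⟩
      exact h
  have hE : (B + cornerMatrix m n t).submatrix f g =
      B.submatrix f g + single 0 0 (if (f 0 : ℕ) = 0 ∧ (g 0 : ℕ) = 0 then t else 0) := by
    ext i j
    simp only [submatrix_apply, Matrix.add_apply, cornerMatrix, of_apply, single_apply, hval hf i,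
      hval hg j, add_right_inj]
    split_ifs <;> grind
  rw [hE, det_add_single_zero_zero]
  rfl

theorem tendsto_add_corner {m n : ℕ} (B : Matrix (Fin m) (Fin n) ℝ) (s : ℝ) :
    Filter.Tendsto (fun δ : ℝ => B + cornerMatrix m n (δ * s)) (nhdsWithin 0 (Set.Ioi 0))
      (nhds B) := by
  have hc : Continuous fun δ : ℝ => B + cornerMatrix m n (δ * s) := by
    refine continuous_const.add (continuous_matrix fun i j => ?_)
    simp only [cornerMatrix, of_apply]
    split_ifs <;> fun_prop
  have h0 : B + cornerMatrix m n (0 * s) = B := by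
    ext i j
    simp [cornerMatrix]
  have := hc.tendsto 0
  rw [h0] at this
  exact this.mono_left nhdsWithin_le_nhds

/-- If all minors of one order vanish, so do all minors of larger order. -/
theorem det_submatrix_eq_zero_of_le {R : Type*} [CommRing R] {m n r : ℕ}
    {B : Matrix (Fin m) (Fin n) R}
    (hB : ∀ (f : Fin r → Fin m) (g : Fin r → Fin n), StrictMono f → StrictMono g →
      (B.submatrix f g).det = 0) {q : ℕ} (hq : r ≤ q) :
    ∀ (f : Fin q → Fin m) (g : Fin q → Fin n), StrictMono f → StrictMono g →
      (B.submatrix f g).det = 0 := by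
  induction q, hq using Nat.le_induction with
  | base => exact hB
  | succ q _ ih =>
    intro f g hf hg
    rw [det_succ_row_zero]
    refine Finset.sum_eq_zero fun j _ => ?_
    rw [submatrix_submatrix, ih _ _ (hf.comp Fin.strictMono_succ)
      (hg.comp (Fin.strictMono_succAbove j)), mul_zero]

end Corner

section Density

/-- Sign regularity of order `k` with strictness up to order `r`. -/
def IsPartiallySSR {m n : ℕ} (k : ℕ) (ε : ℕ → ℝ) (r : ℕ) (A : Matrix (Fin m) (Fin n) ℝ) : Prop :=
  ∀ q ≤ k, ∀ (f : Fin q → Fin m) (g : Fin q → Fin n), StrictMono f → StrictMono g →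
    0 ≤ ε q * (A.submatrix f g).det ∧ (q ≤ r → 0 < ε q * (A.submatrix f g).det)

variable {m n k r : ℕ} {ε : ℕ → ℝ} {B : Matrix (Fin m) (Fin n) ℝ}

theorem IsPartiallySSR.mem_closure_succ_of_det_ne_zero (hkm : k ≤ m) (hkn : k ≤ n)
    (hε : ∀ q ≤ k, ε q ≠ 0) (hB : IsPartiallySSR k ε r B)
    {f₀ : Fin (r + 1) → Fin m} {g₀ : Fin (r + 1) → Fin n} (hf₀ : StrictMono f₀)
    (hg₀ : StrictMono g₀) (h₀ : (B.submatrix f₀ g₀).det ≠ 0) :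
    B ∈ closure {A | IsPartiallySSR k ε (r + 1) A} := by
  have hc : Continuous fun P : Matrix (Fin m) (Fin m) ℝ × Matrix (Fin n) (Fin n) ℝ =>
      P.1 * B * P.2 :=
    (continuous_fst.matrix_mul continuous_const).matrix_mul continuous_snd
  have hB1 := hc.tendsto (1, 1)
  simp only [Matrix.one_mul, Matrix.mul_one] at hB1
  have hlim := hB1.comp ((tendsto_scaledCauchy m).prodMk_nhds (tendsto_scaledCauchy n))
  refine mem_closure_of_tendsto hlim ?_
  filter_upwards [Filter.eventually_gt_atTop 1] with t ht q hqk f g hf hg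
  have hG := isStrictlyTotallyPositive_scaledCauchy m ht
  have hH := isStrictlyTotallyPositive_scaledCauchy n ht
  have hnn := fun (f : Fin q → Fin m) (g : Fin q → Fin n) hf hg => (hB q hqk f g hf hg).1
  refine ⟨nonneg_det_submatrix_mul_mul hG hH hnn hf hg, fun hqr => ?_⟩
  rcases hqr.lt_or_eq with hlt | rfl
  · have hm : StrictMono (Fin.castLE (hqk.trans hkm)) := Fin.strictMono_castLE _
    have hn : StrictMono (Fin.castLE (hqk.trans hkn)) := Fin.strictMono_castLE _
    exact pos_det_submatrix_mul_mul hG hH hnn hm hn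
      ((hB q hqk _ _ hm hn).2 (Nat.lt_succ_iff.1 hlt)) hf hg
  · exact pos_det_submatrix_mul_mul hG hH hnn hf₀ hg₀
      ((hnn f₀ g₀ hf₀ hg₀).lt_of_ne' (mul_ne_zero (hε _ hqk) h₀)) hf hg

theorem IsPartiallySSR.eventually_strict (hrk : r ≤ k) (hB : IsPartiallySSR k ε r B) :
    ∀ᶠ A in nhds B, ∀ q ≤ r, ∀ (f : Fin q → Fin m) (g : Fin q → Fin n),
      StrictMono f → StrictMono g → 0 < ε q * (A.submatrix f g).det := by
  refine (Set.finite_Iic r).eventually_all.2 fun q hq => Filter.eventually_all.2 fun f =>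
    Filter.eventually_all.2 fun g => ?_
  by_cases hfg : StrictMono f ∧ StrictMono g
  · have hc : Continuous fun A : Matrix (Fin m) (Fin n) ℝ => ε q * (A.submatrix f g).det := by
      fun_prop
    filter_upwards [hc.continuousAt.eventually_const_lt
      ((hB q (le_trans hq hrk) f g hfg.1 hfg.2).2 hq)] with A hA _ _
    exact hA
  · exact Filter.Eventually.of_forall fun A hf hg => absurd ⟨hf, hg⟩ hfg

theorem IsPartiallySSR.mem_closure_succ_of_det_eq_zero (hkm : k ≤ m) (hkn : k ≤ n)
    (hε : ∀ q ≤ k, ε q = 1 ∨ ε q = -1) (hr : r + 1 ≤ k) (hB : IsPartiallySSR k ε r B)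
    (h₀ : ∀ (f : Fin (r + 1) → Fin m) (g : Fin (r + 1) → Fin n), StrictMono f → StrictMono g →
      (B.submatrix f g).det = 0) :
    B ∈ closure {A | IsPartiallySSR k ε (r + 1) A} := by
  have hrk : r ≤ k := by omega
  have hsq : ∀ q ≤ k, ε q * ε q = 1 := fun q hq => by rcases hε q hq with h | h <;> simp [h]
  have hne : ∀ q ≤ k, ε q ≠ 0 := fun q hq h => by simpa [h] using hsq q hq
  rw [← closure_closure]
  have hlim := tendsto_add_corner B (ε (r + 1) * ε r)
  refine mem_closure_of_tendsto hlim ?_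
  filter_upwards [hlim.eventually (hB.eventually_strict hrk), self_mem_nhdsWithin] with δ hstrict hδ
  have hδ : 0 < δ := hδ
  have hdet (f : Fin (r + 1) → Fin m) (g : Fin (r + 1) → Fin n) (hf : StrictMono f)
      (hg : StrictMono g) : ε (r + 1) *
        ((B + cornerMatrix m n (δ * (ε (r + 1) * ε r))).submatrix f g).det =
      if (f 0 : ℕ) = 0 ∧ (g 0 : ℕ) = 0 then
        δ * (ε r * (B.submatrix (f ∘ Fin.succ) (g ∘ Fin.succ)).det) else 0 := by
    rw [det_submatrix_add_corner B _ hf hg, h₀ f g hf hg]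
    split_ifs
    · linear_combination
        (δ * ε r * (B.submatrix (f ∘ Fin.succ) (g ∘ Fin.succ)).det) * hsq (r + 1) hr
    · ring
  have hminor (f : Fin (r + 1) → Fin m) (g : Fin (r + 1) → Fin n) (hf : StrictMono f)
      (hg : StrictMono g) :
      0 < δ * (ε r * (B.submatrix (f ∘ Fin.succ) (g ∘ Fin.succ)).det) :=
    mul_pos hδ ((hB r hrk _ _ (hf.comp Fin.strictMono_succ) (hg.comp Fin.strictMono_succ)).2 le_rfl)
  have hB' : IsPartiallySSR k ε r (B + cornerMatrix m n (δ * (ε (r + 1) * ε r))) := by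
    intro q hqk f g hf hg
    rcases le_or_gt q r with hqr | hqr
    · exact ⟨(hstrict q hqr f g hf hg).le, fun _ => hstrict q hqr f g hf hg⟩
    refine ⟨?_, fun h => absurd hqr h.not_gt⟩
    rcases (Nat.succ_le_of_lt hqr).eq_or_lt with rfl | hlt
    · rw [hdet f g hf hg]
      split_ifs
      exacts [(hminor f g hf hg).le, le_rfl]
    · obtain ⟨p, rfl⟩ : ∃ p, q = p + 1 := ⟨q - 1, by omega⟩
      rw [det_submatrix_add_corner B _ hf hg,
        det_submatrix_eq_zero_of_le h₀ hlt.le f g hf hg,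
        det_submatrix_eq_zero_of_le h₀ (Nat.lt_succ_iff.1 hlt) _ _
          (hf.comp Fin.strictMono_succ) (hg.comp Fin.strictMono_succ)]
      simp
  have hm : StrictMono (Fin.castLE (hr.trans hkm)) := Fin.strictMono_castLE _
  have hn : StrictMono (Fin.castLE (hr.trans hkn)) := Fin.strictMono_castLE _
  refine hB'.mem_closure_succ_of_det_ne_zero hkm hkn hne hm hn fun h => ?_
  have h1 := hdet _ _ hm hn
  rw [h, if_pos (by simp), mul_zero] at h1
  exact (hminor _ _ hm hn).ne h1

theorem IsPartiallySSR.mem_closure (hkm : k ≤ m) (hkn : k ≤ n)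
    (hε : ∀ q ≤ k, ε q = 1 ∨ ε q = -1) (hB : IsPartiallySSR k ε 0 B) (hr : r ≤ k) :
    B ∈ closure {A | IsPartiallySSR k ε r A} := by
  induction r with
  | zero => exact subset_closure hB
  | succ r ih =>
    refine closure_minimal (fun A hA => ?_) isClosed_closure (ih (by omega))
    by_cases h₀ : ∀ (f : Fin (r + 1) → Fin m) (g : Fin (r + 1) → Fin n), StrictMono f →
        StrictMono g → (A.submatrix f g).det = 0
    · exact hA.mem_closure_succ_of_det_eq_zero hkm hkn hε hr h₀
    · push Not at h₀
      obtain ⟨f, g, hf, hg, h⟩ := h₀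
      refine IsPartiallySSR.mem_closure_succ_of_det_ne_zero hkm hkn (fun q hq h => ?_) hA hf hg h
      rcases hε q hq with h' | h' <;> norm_num [h'] at h

end Density

/-- Gantmacher–Krein density theorem: given `m, n ≥ k ≥ 1` and a
sign pattern `ε ∈ {1,-1}^k`, the `m × n` SSRₖ(ε) matrices are dense in the
`m × n` SRₖ(ε) matrices: every SRₖ(ε) matrix lies in the closure of the set of
SSRₖ(ε) matrices. -/
theorem ssr_dense_in_sr (m n k : ℕ) (hk : 1 ≤ k) (hkm : k ≤ m) (hkn : k ≤ n)
    (ε : ℕ → ℝ) (hε : ∀ r : ℕ, 1 ≤ r → r ≤ k → ε r = 1 ∨ ε r = -1) :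
    {A : Matrix (Fin m) (Fin n) ℝ | IsSRkPat k ε A} ⊆
      closure {A : Matrix (Fin m) (Fin n) ℝ | IsSSRkPat k ε A} := by
  intro A hA
  have hpos : ∀ q : ℕ, 1 ≤ q → Function.update ε 0 1 q = ε q := fun q hq =>
    Function.update_of_ne (by omega) _ _
  have hε' : ∀ q ≤ k, Function.update ε 0 1 q = 1 ∨ Function.update ε 0 1 q = -1 := by
    intro q hq
    rcases Nat.eq_zero_or_pos q with rfl | h
    · simp
    · rw [hpos q h]
      exact hε q h hq
  have hA' : IsPartiallySSR k (Function.update ε 0 1) 0 A := by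
    intro q hq f g hf hg
    rcases Nat.eq_zero_or_pos q with rfl | h
    · simp
    · refine ⟨?_, fun h' => absurd h h'.not_gt⟩
      rw [hpos q h]
      by_cases hd : (A.submatrix f g).det = 0
      · simp [hd]
      · exact (hA q h hq f g hf hg hd).le
  refine closure_mono (fun C hC q hq hqk f g hf hg => ?_)
    (hA'.mem_closure hkm hkn hε' (le_refl k))
  rw [← hpos q hq]
  exact (hC q hqk f g hf hg).2 hqk
end
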